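/- arXiv:2008.00063 — 8 statements merged into one kernel-verified Lean document; each statement's English description precedes it below -/
import Mathlib

section
/- Let V be a finite-dimensional real vector space, S ⊆ V a PL set, and C ⊆ V a polyhedral cone, i.e. an intersection of finitely many closed linear half-spaces (equivalently, the cone of nonnegative real combinations of a finite set of vectors). Then the Minkowski sum S + C = {s + c : s ∈ S, c ∈ C} is a PL subset of V. -/
open Pointwise

/-- An open or closed affine half-space in a real vector space `V`. -/
def IsHalfSpace {V : Type} [AddCommGroup V] [Module ℝ V] (H : Set V) : Prop :=
  ∃ (f : V →ₗ[ℝ] ℝ) (c : ℝ), f ≠ 0 ∧ (H = {x | f x ≤ c} ∨ H = {x | f x < c})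

/-- A convex polyhedron: an intersection of finitely many open or closed half-spaces. -/
def IsPolyhedron {V : Type} [AddCommGroup V] [Module ℝ V] (P : Set V) : Prop :=
  ∃ (m : ℕ) (H : Fin m → Set V), (∀ i, IsHalfSpace (H i)) ∧ P = ⋂ i, H i

/-- A PL (piecewise linear) set: a finite union of convex polyhedra. -/
def IsPL {V : Type} [AddCommGroup V] [Module ℝ V] (S : Set V) : Prop :=
  ∃ (m : ℕ) (P : Fin m → Set V), (∀ i, IsPolyhedron (P i)) ∧ S = ⋃ i, P i

/-- A polyhedral cone: an intersection of finitely many closed linear half-spaces. -/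
def IsPolyhedralCone {V : Type} [AddCommGroup V] [Module ℝ V] (C : Set V) : Prop :=
  ∃ (m : ℕ) (f : Fin m → (V →ₗ[ℝ] ℝ)), C = ⋂ i, {x | 0 ≤ f i x}

section PiecewiseLinear

variable {V W : Type} [AddCommGroup V] [Module ℝ V] [AddCommGroup W] [Module ℝ W]

lemma isPolyhedron_iInter {ι : Type} [Finite ι] {H : ι → Set V} (hH : ∀ i, IsHalfSpace (H i)) :
    IsPolyhedron (⋂ i, H i) := by
  obtain ⟨n, ⟨e⟩⟩ := Finite.exists_equiv_fin ι
  exact ⟨n, fun i => H (e.symm i), fun i => hH _, (e.symm.surjective.iInter_comp H).symm⟩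

lemma isPL_iUnion_isPolyhedron {ι : Type} [Finite ι] {P : ι → Set V}
    (hP : ∀ i, IsPolyhedron (P i)) : IsPL (⋃ i, P i) := by
  obtain ⟨n, ⟨e⟩⟩ := Finite.exists_equiv_fin ι
  exact ⟨n, fun i => P (e.symm i), fun i => hP _, (e.symm.surjective.iUnion_comp P).symm⟩

lemma IsHalfSpace.isPolyhedron {H : Set V} (hH : IsHalfSpace H) : IsPolyhedron H :=
  ⟨1, fun _ => H, fun _ => hH, (Set.iInter_const H).symm⟩

lemma IsPolyhedron.isPL {P : Set V} (hP : IsPolyhedron P) : IsPL P :=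
  ⟨1, fun _ => P, fun _ => hP, (Set.iUnion_const P).symm⟩

lemma isPL_univ : IsPL (Set.univ : Set V) :=
  IsPolyhedron.isPL ⟨0, Fin.elim0, fun i => i.elim0, (Set.iInter_of_empty _).symm⟩

lemma isPL_empty : IsPL (∅ : Set V) :=
  ⟨0, Fin.elim0, fun i => i.elim0, (Set.iUnion_of_empty _).symm⟩

lemma IsPolyhedron.inter {P Q : Set V} (hP : IsPolyhedron P) (hQ : IsPolyhedron Q) :
    IsPolyhedron (P ∩ Q) := by
  obtain ⟨m, H, hH, rfl⟩ := hP
  obtain ⟨n, K, hK, rfl⟩ := hQ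
  have h : (⋂ i, H i) ∩ (⋂ j, K j) = ⋂ i, Sum.elim H K i := by
    rw [Set.iInter_sum]
    rfl
  rw [h]
  exact isPolyhedron_iInter (Sum.rec hH hK)

lemma IsPL.iUnion {ι : Type} [Finite ι] {S : ι → Set V} (hS : ∀ i, IsPL (S i)) :
    IsPL (⋃ i, S i) := by
  choose m P hP hSP using hS
  have h : (⋃ i, S i) = ⋃ x : (Σ i, Fin (m i)), P x.1 x.2 := by
    rw [Set.iUnion_sigma]
    exact Set.iUnion_congr hSP
  rw [h]
  exact isPL_iUnion_isPolyhedron fun x => hP x.1 x.2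

lemma IsPL.union {S T : Set V} (hS : IsPL S) (hT : IsPL T) : IsPL (S ∪ T) := by
  rw [Set.union_eq_iUnion]
  exact IsPL.iUnion (Bool.rec hT hS)

lemma IsPL.inter {S T : Set V} (hS : IsPL S) (hT : IsPL T) : IsPL (S ∩ T) := by
  obtain ⟨m, P, hP, rfl⟩ := hS
  obtain ⟨n, Q, hQ, rfl⟩ := hT
  rw [Set.iUnion_inter]
  refine IsPL.iUnion fun i => ?_
  rw [Set.inter_iUnion]
  exact IsPL.iUnion fun j => ((hP i).inter (hQ j)).isPL

lemma IsPL.iInter {ι : Type} [Finite ι] {S : ι → Set V} (hS : ∀ i, IsPL (S i)) :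
    IsPL (⋂ i, S i) := by
  classical
  cases nonempty_fintype ι
  suffices h : ∀ s : Finset ι, IsPL (⋂ i ∈ s, S i) by simpa using h Finset.univ
  intro s
  induction s using Finset.induction_on with
  | empty => simpa using isPL_univ
  | insert a s _ ih =>
    rw [Finset.set_biInter_insert]
    exact (hS a).inter ih

lemma isPL_setOf_le (f : V →ₗ[ℝ] ℝ) (c : ℝ) : IsPL {x | f x ≤ c} := by
  by_cases hf : f = 0
  · subst hf
    by_cases hc : 0 ≤ c
    · simpa [hc] using isPL_univ
    · simpa [hc] using isPL_empty
  · exact (IsHalfSpace.isPolyhedron ⟨f, c, hf, Or.inl rfl⟩).isPL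

lemma isPL_setOf_lt (f : V →ₗ[ℝ] ℝ) (c : ℝ) : IsPL {x | f x < c} := by
  by_cases hf : f = 0
  · subst hf
    by_cases hc : 0 < c
    · simpa [hc] using isPL_univ
    · simpa [hc] using isPL_empty
  · exact (IsHalfSpace.isPolyhedron ⟨f, c, hf, Or.inr rfl⟩).isPL

lemma IsPL.preimage {S : Set W} (hS : IsPL S) (L : V →ₗ[ℝ] W) : IsPL (L ⁻¹' S) := by
  obtain ⟨m, P, hP, rfl⟩ := hS
  rw [Set.preimage_iUnion]
  refine IsPL.iUnion fun i => ?_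
  obtain ⟨n, H, hH, hPi⟩ := hP i
  rw [hPi, Set.preimage_iInter]
  refine IsPL.iInter fun j => ?_
  obtain ⟨f, c, -, h | h⟩ := hH j
  · rw [h]
    exact isPL_setOf_le (f ∘ₗ L) c
  · rw [h]
    exact isPL_setOf_lt (f ∘ₗ L) c

lemma IsPolyhedralCone.isPL {C : Set V} (hC : IsPolyhedralCone C) : IsPL C := by
  obtain ⟨m, f, rfl⟩ := hC
  refine IsPL.iInter fun i => ?_
  simpa using isPL_setOf_le (-f i) 0

/-- The half-space `{f ≤ c}` if `p` holds and `{f < c}` otherwise; this treats closed and open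
half-spaces uniformly. -/
def halfSpace (f : V →ₗ[ℝ] ℝ) (c : ℝ) (p : Prop) : Set V :=
  {x | f x < c ∨ (p ∧ f x = c)}

lemma mem_halfSpace {f : V →ₗ[ℝ] ℝ} {c : ℝ} {p : Prop} {x : V} :
    x ∈ halfSpace f c p ↔ f x < c ∨ (p ∧ f x = c) := Iff.rfl

lemma halfSpace_true (f : V →ₗ[ℝ] ℝ) (c : ℝ) : halfSpace f c True = {x | f x ≤ c} := by
  ext x
  simp [mem_halfSpace, le_iff_lt_or_eq]

lemma halfSpace_false (f : V →ₗ[ℝ] ℝ) (c : ℝ) : halfSpace f c False = {x | f x < c} := by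
  ext x
  simp [mem_halfSpace]

lemma isPL_halfSpace (f : V →ₗ[ℝ] ℝ) (c : ℝ) (p : Prop) : IsPL (halfSpace f c p) := by
  by_cases hp : p
  · simpa [hp, halfSpace_true] using isPL_setOf_le f c
  · simpa [hp, halfSpace_false] using isPL_setOf_lt f c

lemma IsHalfSpace.exists_eq_halfSpace {H : Set V} (hH : IsHalfSpace H) :
    ∃ f c p, H = halfSpace f c p := by
  obtain ⟨f, c, -, h | h⟩ := hH
  · exact ⟨f, c, True, by rw [h, halfSpace_true]⟩
  · exact ⟨f, c, False, by rw [h, halfSpace_false]⟩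

lemma IsHalfSpace.convex {H : Set V} (hH : IsHalfSpace H) : Convex ℝ H := by
  obtain ⟨f, c, -, rfl | rfl⟩ := hH
  · exact convex_halfSpace_le f.isLinear c
  · exact convex_halfSpace_lt f.isLinear c

lemma add_smul_mem_halfSpace_of_apply_eq_zero {f : V →ₗ[ℝ] ℝ} {c : ℝ} {p : Prop} {e : V}
    (he : f e = 0) (x : V) (t : ℝ) : x + t • e ∈ halfSpace f c p ↔ x ∈ halfSpace f c p := by
  simp [mem_halfSpace, he]

lemma isPL_exists_add_smul_mem_halfSpace (f : V →ₗ[ℝ] ℝ) (c : ℝ) (p : Prop) (e : V) :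
    IsPL {x | ∃ t : ℝ, x + t • e ∈ halfSpace f c p} := by
  by_cases he : f e = 0
  · simpa [add_smul_mem_halfSpace_of_apply_eq_zero he] using isPL_halfSpace f c p
  · convert isPL_univ (V := V)
    refine Set.eq_univ_of_forall fun x => ⟨(c - 1 - f x) / f e, Or.inl ?_⟩
    simp [he]

/-- A Fourier–Motzkin elimination step. -/
lemma exists_add_smul_mem_halfSpace_inter_iff {f g : V →ₗ[ℝ] ℝ} {c d : ℝ} {p q : Prop} {e : V}
    (hf : 0 < f e) (hg : g e < 0) (x : V) :
    (∃ t : ℝ, x + t • e ∈ halfSpace f c p ∩ halfSpace g d q) ↔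
      x ∈ halfSpace (-g e • f + f e • g) (-g e * c + f e * d) (p ∧ q) := by
  simp only [Set.mem_inter_iff, mem_halfSpace, map_add, map_smul, smul_eq_mul,
    LinearMap.add_apply, LinearMap.smul_apply]
  constructor
  · rintro ⟨t, h₁ | ⟨hp, h₁⟩, h₂ | ⟨hq, h₂⟩⟩
    · left; nlinarith
    · left; nlinarith
    · left; nlinarith
    · exact Or.inr ⟨⟨hp, hq⟩, by rw [← h₁, ← h₂]; ring⟩
  · obtain ⟨u, hu⟩ : ∃ u, f x = c - u * f e := ⟨(c - f x) / f e, by field_simp; ring⟩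
    obtain ⟨l, hl⟩ : ∃ l, g x = d - l * g e := ⟨(d - g x) / g e, by field_simp [hg.ne]; ring⟩
    rw [hu, hl]
    rintro (h | ⟨⟨hp, hq⟩, h⟩)
    · have hlu : l < u := by
        have := mul_neg_of_pos_of_neg hf hg
        nlinarith
      exact ⟨(l + u) / 2, Or.inl (by nlinarith), Or.inl (by nlinarith)⟩
    · have hlu : l = u := by
        have h' : (f e * g e) * (u - l) = 0 := by linarith
        rcases mul_eq_zero.1 h' with h' | h'
        · exact absurd h' (mul_neg_of_pos_of_neg hf hg).ne
        · linarith
      exact ⟨u, Or.inr ⟨hp, by ring⟩, Or.inr ⟨hq, by rw [hlu]; ring⟩⟩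

lemma exists_add_smul_mem_halfSpace_inter {f g : V →ₗ[ℝ] ℝ} {e : V} (h : 0 < f e * g e)
    (c d : ℝ) (p q : Prop) (x : V) :
    ∃ t : ℝ, x + t • e ∈ halfSpace f c p ∩ halfSpace g d q := by
  simp only [Set.mem_inter_iff, mem_halfSpace, map_add, map_smul, smul_eq_mul]
  have hf : f e ≠ 0 := left_ne_zero_of_mul h.ne'
  have hg : g e ≠ 0 := right_ne_zero_of_mul h.ne'
  obtain ⟨u, hu⟩ : ∃ u, f x = c - u * f e := ⟨(c - f x) / f e, by field_simp; ring⟩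
  obtain ⟨l, hl⟩ : ∃ l, g x = d - l * g e := ⟨(d - g x) / g e, by field_simp; ring⟩
  rw [hu, hl]
  rcases pos_and_pos_or_neg_and_neg_of_mul_pos h with ⟨h₁, h₂⟩ | ⟨h₁, h₂⟩
  · exact ⟨min u l - 1, Or.inl (by nlinarith [min_le_left u l]),
      Or.inl (by nlinarith [min_le_right u l])⟩
  · exact ⟨max u l + 1, Or.inl (by nlinarith [le_max_left u l]),
      Or.inl (by nlinarith [le_max_right u l])⟩

lemma isPL_exists_add_smul_mem_halfSpace_inter (f g : V →ₗ[ℝ] ℝ) (c d : ℝ) (p q : Prop) (e : V) :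
    IsPL {x | ∃ t : ℝ, x + t • e ∈ halfSpace f c p ∩ halfSpace g d q} := by
  rcases lt_trichotomy (f e * g e) 0 with h | h | h
  · rcases mul_neg_iff.1 h with ⟨hf, hg⟩ | ⟨hf, hg⟩
    · simp only [exists_add_smul_mem_halfSpace_inter_iff hf hg]
      exact isPL_halfSpace _ _ _
    · simp only [Set.inter_comm (halfSpace f c p), exists_add_smul_mem_halfSpace_inter_iff hg hf]
      exact isPL_halfSpace _ _ _
  · rcases mul_eq_zero.1 h with he | he
    · simp only [Set.mem_inter_iff, add_smul_mem_halfSpace_of_apply_eq_zero he, exists_and_left]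
      exact (isPL_halfSpace f c p).inter (isPL_exists_add_smul_mem_halfSpace g d q e)
    · simp only [Set.mem_inter_iff, add_smul_mem_halfSpace_of_apply_eq_zero he, exists_and_right]
      exact (isPL_exists_add_smul_mem_halfSpace f c p e).inter (isPL_halfSpace g d q)
  · convert isPL_univ (V := V)
    exact Set.eq_univ_of_forall (exists_add_smul_mem_halfSpace_inter h c d p q)

/-- Helly's theorem on the real line: finitely many convex sets that meet pairwise have a
common point. -/
lemma nonempty_iInter_of_convex_real {ι : Type} [Finite ι] {F : ι → Set ℝ}
    (hF : ∀ i, Convex ℝ (F i)) (h : ∀ i j, (F i ∩ F j).Nonempty) : (⋂ i, F i).Nonempty := by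
  classical
  cases nonempty_fintype ι
  have key := Convex.helly_theorem' (𝕜 := ℝ) (s := Finset.univ) (F := F) (fun i _ => hF i) ?_
  · simpa using key
  · intro I _ hI
    rw [Module.finrank_self] at hI
    rcases I.eq_empty_or_nonempty with rfl | ⟨i, hi⟩
    · simp
    have hI' : (I.erase i).card ≤ 1 := by
      rw [Finset.card_erase_of_mem hi]
      omega
    rcases (I.erase i).eq_empty_or_nonempty with hemp | ⟨j, hj⟩
    · obtain ⟨t, ht, -⟩ := h i i
      refine ⟨t, Set.mem_iInter₂.2 fun k hk => ?_⟩
      by_cases hki : k = i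
      · exact hki ▸ ht
      · exact absurd (Finset.mem_erase.2 ⟨hki, hk⟩) (by simp [hemp])
    · obtain ⟨t, hti, htj⟩ := h i j
      refine ⟨t, Set.mem_iInter₂.2 fun k hk => ?_⟩
      by_cases hki : k = i
      · exact hki ▸ hti
      · rwa [Finset.card_le_one.1 hI' k (Finset.mem_erase.2 ⟨hki, hk⟩) j hj]

lemma IsPolyhedron.isPL_exists_add_smul_mem {P : Set V} (hP : IsPolyhedron P) (e : V) :
    IsPL {x | ∃ t : ℝ, x + t • e ∈ P} := by
  obtain ⟨m, H, hH, rfl⟩ := hP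
  have h : {x | ∃ t : ℝ, x + t • e ∈ ⋂ i, H i} =
      ⋂ i, ⋂ j, {x | ∃ t : ℝ, x + t • e ∈ H i ∩ H j} := by
    ext x
    simp only [Set.mem_iInter, Set.mem_ofPred_eq]
    refine ⟨fun ⟨t, ht⟩ i j => ⟨t, ht i, ht j⟩, fun hx => ?_⟩
    have hconv (i) : Convex ℝ {t : ℝ | x + t • e ∈ H i} := by
      have := (hH i).convex.affine_preimage (AffineMap.lineMap x (x + e))
      simpa [Set.preimage, AffineMap.lineMap_apply, add_comm] using this
    obtain ⟨t, ht⟩ := nonempty_iInter_of_convex_real hconv hx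
    exact ⟨t, (Set.mem_iInter.1 ht :)⟩
  rw [h]
  refine IsPL.iInter fun i => IsPL.iInter fun j => ?_
  obtain ⟨f, c, p, hi⟩ := (hH i).exists_eq_halfSpace
  obtain ⟨g, d, q, hj⟩ := (hH j).exists_eq_halfSpace
  rw [hi, hj]
  exact isPL_exists_add_smul_mem_halfSpace_inter f g c d p q e

lemma add_span_singleton_eq (S : Set V) (e : V) :
    S + (Submodule.span ℝ {e} : Set V) = {x | ∃ t : ℝ, x + t • e ∈ S} := by
  ext x
  simp only [Set.mem_add, SetLike.mem_coe, Submodule.mem_span_singleton, Set.mem_ofPred_eq]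
  constructor
  · rintro ⟨s, hs, _, ⟨t, rfl⟩, rfl⟩
    exact ⟨-t, by simpa using hs⟩
  · rintro ⟨t, ht⟩
    exact ⟨_, ht, _, ⟨-t, rfl⟩, by simp⟩

lemma IsPL.add_span_singleton {S : Set V} (hS : IsPL S) (e : V) :
    IsPL (S + (Submodule.span ℝ {e} : Set V)) := by
  obtain ⟨m, P, hP, rfl⟩ := hS
  rw [Set.iUnion_add]
  refine IsPL.iUnion fun i => ?_
  rw [add_span_singleton_eq]
  exact (hP i).isPL_exists_add_smul_mem e

lemma IsPL.add_submodule {S : Set V} (hS : IsPL S) {U : Submodule ℝ V} (hU : U.FG) :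
    IsPL (S + (U : Set V)) := by
  induction U, hU using Submodule.fg_induction generalizing S with
  | singleton e => exact hS.add_span_singleton e
  | sup U₁ U₂ _ _ h₁ h₂ =>
    rw [Submodule.coe_sup, ← add_assoc]
    exact h₂ (h₁ hS)

lemma IsPL.prod {S : Set V} {T : Set W} (hS : IsPL S) (hT : IsPL T) : IsPL (S ×ˢ T) :=
  (hS.preimage (LinearMap.fst ℝ V W)).inter (hT.preimage (LinearMap.snd ℝ V W))

/-- The Minkowski sum of two PL sets is PL. -/
lemma IsPL.add [FiniteDimensional ℝ V] {S T : Set V} (hS : IsPL S) (hT : IsPL T) :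
    IsPL (S + T) := by
  set U : Submodule ℝ (V × V) := LinearMap.ker (LinearMap.coprod LinearMap.id LinearMap.id)
  have h : S + T = LinearMap.inl ℝ V V ⁻¹' (S ×ˢ T + (U : Set (V × V))) := by
    ext x
    constructor
    · rintro ⟨s, hs, t, ht, rfl⟩
      exact ⟨(s, t), ⟨hs, ht⟩, (t, -t), by simp [U], by simp⟩
    · rintro ⟨⟨s, t⟩, ⟨hs, ht⟩, ⟨v, w⟩, hvw, hx⟩
      have hvw' : v + w = 0 := by simpa [U] using hvw
      obtain ⟨h₁, h₂⟩ : s + v = x ∧ t + w = 0 := by simpa using hx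
      refine ⟨s, hs, t, ht, ?_⟩
      rw [← h₁, eq_neg_of_add_eq_zero_left h₂, eq_neg_of_add_eq_zero_left hvw']
  rw [h]
  exact ((hS.prod hT).add_submodule (IsNoetherian.noetherian U)).preimage _

end PiecewiseLinear

/-- In a finite-dimensional real vector space, the Minkowski sum of a PL
set with a polyhedral cone is PL. -/
theorem isPL_add_polyhedralCone {V : Type} [AddCommGroup V] [Module ℝ V]
    [FiniteDimensional ℝ V] (S C : Set V) (hS : IsPL S) (hC : IsPolyhedralCone C) :
    IsPL (S + C) :=
  hS.add hC.isPL
end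

section
/- Let Q be a poset, U ⊆ Q an upset, and D ⊆ Q a downset. Then the k-vector space Hom_Q(k[U], k[D]) of Q-module homomorphisms is isomorphic to k^{π_0(U ∩ D)}, the space of k-valued functions on the set of connected components of U ∩ D. Explicitly: every homomorphism φ : k[U] → k[D] acts in each degree q ∈ U ∩ D as multiplication by a scalar that depends only on the connected component of U ∩ D containing q (and acts as 0 in degrees outside D), and conversely every assignment of one scalar to each connected component of U ∩ D arises from a unique homomorphism. -/
/-- The component of the indicator module `k[S]` in degree `q`: the field `k`
(as the full submodule of itself) if `q ∈ S`, and `0` otherwise. -/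
noncomputable def cmpt (k : Type) [Field k] {Q : Type} (S : Set Q) (q : Q) : Submodule k k :=
  haveI := Classical.dec (q ∈ S)
  if q ∈ S then ⊤ else ⊥

/-- The structure map of the indicator module `k[S]` for `q ≤ q'`:
the identity of `k` when `q, q' ∈ S`, and `0` otherwise. -/
noncomputable def stMap (k : Type) [Field k] {Q : Type} [PartialOrder Q] (S : Set Q)
    {q q' : Q} (h : q ≤ q') : ↥(cmpt k S q) →ₗ[k] ↥(cmpt k S q') :=
  haveI := Classical.dec (q ∈ S ∧ q' ∈ S)
  if hq : q ∈ S ∧ q' ∈ S then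
    Submodule.inclusion (by simp [cmpt, hq.1, hq.2])
  else 0

/-- The space of `Q`-module homomorphisms `k[S] → k[T]` between indicator modules:
families of linear maps in each degree commuting with the structure maps. -/
noncomputable def HomQ (k : Type) [Field k] {Q : Type} [PartialOrder Q] (S T : Set Q) :
    Submodule k (∀ q : Q, ↥(cmpt k S q) →ₗ[k] ↥(cmpt k T q)) where
  carrier := {φ | ∀ (q q' : Q) (h : q ≤ q'), stMap k T h ∘ₗ φ q = φ q' ∘ₗ stMap k S h}
  add_mem' := by
    intro a b ha hb
    simp only [Set.mem_setOf_eq] at ha hb ⊢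
    intro q q' h
    ext x
    have ha' := congrArg (fun g => g x) (ha q q' h)
    have hb' := congrArg (fun g => g x) (hb q q' h)
    simp only [LinearMap.comp_apply] at ha' hb' ⊢
    simp only [Pi.add_apply, LinearMap.add_apply, map_add, ha', hb']
  zero_mem' := by
    simp only [Set.mem_setOf_eq]
    intro q q' h
    ext x
    simp
  smul_mem' := by
    intro c a ha
    simp only [Set.mem_setOf_eq] at ha ⊢
    intro q q' h
    ext x
    have ha' := congrArg (fun g => g x) (ha q q' h)
    simp only [LinearMap.comp_apply] at ha' ⊢
    simp only [Pi.smul_apply, LinearMap.smul_apply, map_smul, ha']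

/-- The scalar by which a homomorphism of indicator modules acts in degree `q`. -/
noncomputable def scl {k : Type} [Field k] {Q : Type} {S T : Set Q}
    (φ : ∀ q : Q, ↥(cmpt k S q) →ₗ[k] ↥(cmpt k T q)) (q : Q) (hq : q ∈ S) : k :=
  (φ q ⟨1, by simp [cmpt, hq]⟩ : ↥(cmpt k T q)).1

/-- The set of connected components of a subset `S` of a poset: the quotient of `S`
by the equivalence relation generated by comparability (zigzag paths within `S`). -/
def Pi0 {Q : Type} [PartialOrder Q] (S : Set Q) : Type :=
  Quot (fun a b : S => (a : Q) ≤ (b : Q))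

theorem coe_eq_zero_of_notMem {k : Type} [Field k] {Q : Type} {S : Set Q} {q : Q}
    (hq : q ∉ S) (x : ↥(cmpt k S q)) : (x : k) = 0 := by
  have hx := x.2
  simpa only [cmpt, if_neg hq, Submodule.mem_bot] using hx

theorem mem_cmpt_of_mem {k : Type} [Field k] {Q : Type} {S : Set Q} {q : Q}
    (hq : q ∈ S) (x : k) : x ∈ cmpt k S q := by
  simp [cmpt, hq]

theorem coe_stMap_of_mem {k : Type} [Field k] {Q : Type} [PartialOrder Q] {S : Set Q}
    {q q' : Q} (h : q ≤ q') (hq : q ∈ S) (hq' : q' ∈ S) (x : ↥(cmpt k S q)) :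
    (stMap k S h x : k) = x := by
  simp [stMap, hq, hq']

theorem coe_apply_eq_mul_scl {k : Type} [Field k] {Q : Type} {S T : Set Q}
    (φ : ∀ q : Q, ↥(cmpt k S q) →ₗ[k] ↥(cmpt k T q)) {q : Q} (hq : q ∈ S)
    (x : ↥(cmpt k S q)) : (φ q x : k) = x * scl φ q hq := by
  have hx : x = (x : k) • (⟨1, mem_cmpt_of_mem hq 1⟩ : ↥(cmpt k S q)) := by
    ext; simp
  conv_lhs => rw [hx, map_smul]
  rfl

theorem scl_eq_of_le {k : Type} [Field k] {Q : Type} [PartialOrder Q] {S T : Set Q}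
    (φ : ↥(HomQ k S T)) {q q' : Q} (h : q ≤ q') (hq : q ∈ S ∩ T) (hq' : q' ∈ S ∩ T) :
    scl φ.1 q hq.1 = scl φ.1 q' hq'.1 := by
  have key := congrArg Subtype.val
    (LinearMap.congr_fun (φ.2 q q' h) ⟨1, mem_cmpt_of_mem hq.1 1⟩)
  simp only [LinearMap.comp_apply] at key
  rw [coe_stMap_of_mem h hq.2 hq'.2, coe_apply_eq_mul_scl _ hq.1,
    coe_apply_eq_mul_scl _ hq'.1, coe_stMap_of_mem h hq.1 hq'.1] at key
  simpa using key

/-- The scalars by which a homomorphism of indicator modules acts, as a function on the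
connected components of the intersection. -/
noncomputable def componentScalars (k : Type) [Field k] {Q : Type} [PartialOrder Q]
    (S T : Set Q) : ↥(HomQ k S T) →ₗ[k] (Pi0 (S ∩ T) → k) where
  toFun φ := Quot.lift (fun q => scl φ.1 q.1 q.2.1) fun a b h => scl_eq_of_le φ h a.2 b.2
  map_add' φ ψ := by
    funext c
    induction c using Quot.ind
    rfl
  map_smul' a φ := by
    funext c
    induction c using Quot.ind
    rfl

theorem componentScalars_injective (k : Type) [Field k] {Q : Type} [PartialOrder Q]
    (S T : Set Q) : Function.Injective (componentScalars k S T) := by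
  intro φ ψ h
  ext q x
  by_cases hS : q ∈ S
  · by_cases hT : q ∈ T
    · rw [coe_apply_eq_mul_scl _ hS, coe_apply_eq_mul_scl _ hS]
      exact congrArg _ (congrFun h (Quot.mk _ ⟨q, hS, hT⟩))
    · rw [coe_eq_zero_of_notMem hT, coe_eq_zero_of_notMem hT]
  · obtain rfl : x = 0 := Subtype.ext (coe_eq_zero_of_notMem hS x)
    simp

open Classical in
/-- Extension by zero of a function on the connected components of `S` to all degrees. -/
noncomputable def scalarAt {k : Type} [Field k] {Q : Type} [PartialOrder Q] {S : Set Q}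
    (f : Pi0 S → k) (q : Q) : k :=
  if hq : q ∈ S then f (Quot.mk _ ⟨q, hq⟩) else 0

theorem scalarAt_of_mem {k : Type} [Field k] {Q : Type} [PartialOrder Q] {S : Set Q}
    (f : Pi0 S → k) {q : Q} (hq : q ∈ S) : scalarAt f q = f (Quot.mk _ ⟨q, hq⟩) :=
  dif_pos hq

/-- Multiplication in each degree by the scalar prescribed on its connected component. -/
noncomputable def mulScalars {k : Type} [Field k] {Q : Type} [PartialOrder Q] {S T : Set Q}
    (f : Pi0 (S ∩ T) → k) (q : Q) : ↥(cmpt k S q) →ₗ[k] ↥(cmpt k T q) :=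
  LinearMap.codRestrict _ (scalarAt f q • (cmpt k S q).subtype) fun x => by
    by_cases hT : q ∈ T
    · exact mem_cmpt_of_mem hT _
    · simp [scalarAt, hT]

theorem coe_mulScalars {k : Type} [Field k] {Q : Type} [PartialOrder Q] {S T : Set Q}
    (f : Pi0 (S ∩ T) → k) (q : Q) (x : ↥(cmpt k S q)) :
    (mulScalars f q x : k) = scalarAt f q * x :=
  rfl

theorem mulScalars_mem_HomQ {k : Type} [Field k] {Q : Type} [PartialOrder Q] {U D : Set Q}
    (hU : IsUpperSet U) (hD : IsLowerSet D) (f : Pi0 (U ∩ D) → k) :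
    mulScalars f ∈ HomQ k U D := by
  intro q q' h
  ext x
  simp only [LinearMap.comp_apply]
  by_cases hq : q ∈ U
  · by_cases hq' : q' ∈ D
    · have hqD := hD h hq'
      have hqU := hU h hq
      rw [coe_stMap_of_mem h hqD hq', coe_mulScalars, coe_mulScalars,
        coe_stMap_of_mem h hq hqU, scalarAt_of_mem f ⟨hq, hqD⟩,
        scalarAt_of_mem f ⟨hqU, hq'⟩]
      exact congrArg (f · * (x : k)) (Quot.sound h)
    · rw [coe_eq_zero_of_notMem hq', coe_eq_zero_of_notMem hq']
  · obtain rfl : x = 0 := Subtype.ext (coe_eq_zero_of_notMem hq x)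
    simp

theorem componentScalars_surjective (k : Type) [Field k] {Q : Type} [PartialOrder Q]
    {U D : Set Q} (hU : IsUpperSet U) (hD : IsLowerSet D) :
    Function.Surjective (componentScalars k U D) := by
  intro f
  refine ⟨⟨mulScalars f, mulScalars_mem_HomQ hU hD f⟩, ?_⟩
  funext c
  induction c using Quot.ind with
  | mk q =>
    change scalarAt f q.1 * 1 = _
    rw [mul_one, scalarAt_of_mem f q.2]

/-- For an upset `U` and a downset `D` in a poset `Q`, the vector space
`Hom_Q(k[U], k[D])` is isomorphic to `k^{π₀(U ∩ D)}`, the space of `k`-valued functions on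
the set of connected components of `U ∩ D`; explicitly, every homomorphism acts in each
degree `q ∈ U ∩ D` by a scalar depending only on the component of `q`, acts by `0` outside
`D`, and every choice of scalars on components arises from a unique homomorphism. -/
theorem hom_upset_module_downset_module (k : Type) [Field k] (Q : Type) [PartialOrder Q]
    (U D : Set Q) (hU : IsUpperSet U) (hD : IsLowerSet D) :
    ∃ e : ↥(HomQ k U D) ≃ₗ[k] (Pi0 (U ∩ D) → k),
      (∀ (φ : ↥(HomQ k U D)) (q : Q) (hq : q ∈ U ∩ D),
        scl φ.1 q hq.1 = e φ (Quot.mk _ ⟨q, hq⟩)) ∧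
      (∀ (φ : ↥(HomQ k U D)) (q : Q), q ∈ U → q ∉ D → φ.1 q = 0) := by
  refine ⟨LinearEquiv.ofBijective (componentScalars k U D)
    ⟨componentScalars_injective k U D, componentScalars_surjective k hU hD⟩,
    fun _ _ _ => rfl, fun φ q _ hqD => ?_⟩
  ext x
  exact coe_eq_zero_of_notMem hqD _
end

section
/- Let Q be a poset and D, D′ ⊆ Q downsets. Then Hom_Q(k[D], k[D′]) is isomorphic to k^{{S ∈ π_0(D′) : S ⊆ D}}, the space of k-valued functions on the set of connected components of D′ that are contained in D. Explicitly: every homomorphism k[D] → k[D′] acts by a single scalar in all degrees of each connected component of D′ contained in D and is zero in degrees of components of D′ not contained in D, and every such choice of scalars arises from a unique homomorphism. -/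
/-- The connected component `c` of `S` is contained in the subset `T`. -/
def compSub {Q : Type} [PartialOrder Q] (S T : Set Q) (c : Pi0 S) : Prop :=
  ∀ a : S, Quot.mk _ a = c → (a : Q) ∈ T

section IndicatorModules

variable {k : Type} [Field k] {Q : Type}

theorem mem_cmpt_iff {S : Set Q} {q : Q} {x : k} : x ∈ cmpt k S q ↔ (q ∉ S → x = 0) := by
  by_cases hq : q ∈ S <;> simp [cmpt, hq]

theorem eq_zero_of_mem_cmpt {S : Set Q} {q : Q} (hq : q ∉ S) (x : cmpt k S q) : (x : k) = 0 :=
  mem_cmpt_iff.1 x.2 hq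

open Classical in
theorem coe_stMap [PartialOrder Q] {S : Set Q} {q q' : Q} (h : q ≤ q') (x : cmpt k S q) :
    (stMap k S h x : k) = if q' ∈ S then (x : k) else 0 := by
  by_cases hq : q ∈ S
  · by_cases hq' : q' ∈ S <;> simp [stMap, hq, hq']
  · simp [stMap, hq, eq_zero_of_mem_cmpt hq x]

open Classical in
/-- The scalar by which a family of maps acts in degree `q`, extended by zero outside `S`. -/
noncomputable def sclExt {S T : Set Q} (φ : ∀ q : Q, ↥(cmpt k S q) →ₗ[k] ↥(cmpt k T q))
    (q : Q) : k :=
  if hq : q ∈ S then scl φ q hq else 0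

theorem sclExt_of_mem {S T : Set Q} (φ : ∀ q : Q, ↥(cmpt k S q) →ₗ[k] ↥(cmpt k T q))
    {q : Q} (hq : q ∈ S) : sclExt φ q = scl φ q hq :=
  dif_pos hq

theorem sclExt_of_notMem {S T : Set Q} (φ : ∀ q : Q, ↥(cmpt k S q) →ₗ[k] ↥(cmpt k T q))
    {q : Q} (hq : q ∉ S) : sclExt φ q = 0 :=
  dif_neg hq

theorem coe_apply_eq_sclExt_mul {S T : Set Q}
    (φ : ∀ q : Q, ↥(cmpt k S q) →ₗ[k] ↥(cmpt k T q)) (q : Q) (x : cmpt k S q) :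
    (φ q x : k) = sclExt φ q * x := by
  by_cases hq : q ∈ S
  · have hx : x = (x : k) • (⟨1, mem_cmpt_iff.2 fun h => (h hq).elim⟩ : cmpt k S q) := by
      ext; simp
    rw [sclExt_of_mem φ hq, scl, mul_comm, ← smul_eq_mul, ← Submodule.coe_smul, ← map_smul, ← hx]
  · have hx : x = 0 := Subtype.ext (eq_zero_of_mem_cmpt hq x)
    simp [hx]

theorem eq_zero_of_sclExt_eq_zero {S T : Set Q}
    {φ : ∀ q : Q, ↥(cmpt k S q) →ₗ[k] ↥(cmpt k T q)} {q : Q} (h : sclExt φ q = 0) :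
    φ q = 0 := by
  ext x
  simp [coe_apply_eq_sclExt_mul, h]

/-- The scalars of a homomorphism agree in comparable degrees of the target downset. -/
theorem sclExt_eq_of_le [PartialOrder Q] {D D' : Set Q} (hD : IsLowerSet D)
    (φ : HomQ k D D') {q q' : Q} (hq' : q' ∈ D') (h : q ≤ q') :
    sclExt φ.1 q = sclExt φ.1 q' := by
  by_cases hq : q ∈ D
  · have key := congrArg Subtype.val (LinearMap.congr_fun (φ.2 q q' h)
      ⟨1, mem_cmpt_iff.2 fun h => (h hq).elim⟩)
    simp only [LinearMap.comp_apply, coe_stMap, coe_apply_eq_sclExt_mul, if_pos hq', mul_one] at key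
    by_cases hq'D : q' ∈ D
    · simpa [hq'D] using key
    · simpa [hq'D, sclExt_of_notMem φ.1 hq'D] using key
  · rw [sclExt_of_notMem φ.1 hq, sclExt_of_notMem φ.1 fun hq'D => hq (hD h hq'D)]

/-- The scalar of a homomorphism on a connected component of the target downset. -/
noncomputable def componentScl [PartialOrder Q] {D D' : Set Q} (hD : IsLowerSet D)
    (φ : HomQ k D D') : Pi0 D' → k :=
  Quot.lift (fun a : D' => sclExt φ.1 a) fun _ b h => sclExt_eq_of_le hD φ b.2 h

theorem componentScl_eq_zero [PartialOrder Q] {D D' : Set Q} (hD : IsLowerSet D)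
    (φ : HomQ k D D') {c : Pi0 D'} (hc : ¬ compSub D' D c) : componentScl hD φ c = 0 := by
  simp only [compSub, not_forall] at hc
  obtain ⟨a, rfl, ha⟩ := hc
  exact sclExt_of_notMem φ.1 ha

/-- Restriction of the scalars of a homomorphism to the components contained in the source. -/
noncomputable def componentSclLinear [PartialOrder Q] {D D' : Set Q} (hD : IsLowerSet D) :
    HomQ k D D' →ₗ[k] ({c : Pi0 D' // compSub D' D c} → k) where
  toFun φ c := componentScl hD φ c
  map_add' φ ψ := by
    ext ⟨c, hc⟩
    induction c using Quot.ind with | mk a =>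
    have ha := hc a rfl
    simp [componentScl, sclExt_of_mem _ ha, scl]
  map_smul' r φ := by
    ext ⟨c, hc⟩
    induction c using Quot.ind with | mk a =>
    have ha := hc a rfl
    simp [componentScl, sclExt_of_mem _ ha, scl]

theorem componentSclLinear_injective [PartialOrder Q] {D D' : Set Q} (hD : IsLowerSet D) :
    Function.Injective (componentSclLinear (k := k) (D' := D') hD) := by
  refine (injective_iff_map_eq_zero _).2 fun φ hφ => ?_
  ext q : 2
  by_cases hq : q ∈ D'
  · apply eq_zero_of_sclExt_eq_zero
    change componentScl hD φ (Quot.mk _ ⟨q, hq⟩) = 0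
    by_cases hc : compSub D' D (Quot.mk _ ⟨q, hq⟩)
    · exact congrFun hφ ⟨_, hc⟩
    · exact componentScl_eq_zero hD φ hc
  · ext x
    simpa using eq_zero_of_mem_cmpt hq (φ.1 q x)

open Classical in
/-- The scalar in degree `q` prescribed by a function on components, extended by zero. -/
noncomputable def degreeScl [PartialOrder Q] {D D' : Set Q}
    (g : {c : Pi0 D' // compSub D' D c} → k) (q : Q) : k :=
  if h : ∃ hq : q ∈ D', compSub D' D (Quot.mk _ ⟨q, hq⟩) then g ⟨Quot.mk _ ⟨q, h.1⟩, h.2⟩ else 0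

theorem degreeScl_of_compSub [PartialOrder Q] {D D' : Set Q}
    (g : {c : Pi0 D' // compSub D' D c} → k) {q : Q} (hq : q ∈ D')
    (hc : compSub D' D (Quot.mk _ ⟨q, hq⟩)) : degreeScl g q = g ⟨Quot.mk _ ⟨q, hq⟩, hc⟩ :=
  dif_pos ⟨hq, hc⟩

theorem degreeScl_of_notMem_right [PartialOrder Q] {D D' : Set Q}
    (g : {c : Pi0 D' // compSub D' D c} → k) {q : Q} (hq : q ∉ D') : degreeScl g q = 0 :=
  dif_neg fun h => hq h.1

theorem degreeScl_of_notMem_left [PartialOrder Q] {D D' : Set Q}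
    (g : {c : Pi0 D' // compSub D' D c} → k) {q : Q} (hq : q ∉ D) : degreeScl g q = 0 :=
  dif_neg fun h => hq (h.2 _ rfl)

theorem degreeScl_eq_of_le [PartialOrder Q] {D D' : Set Q}
    (g : {c : Pi0 D' // compSub D' D c} → k) {q q' : Q} (hq : q ∈ D') (hq' : q' ∈ D')
    (h : q ≤ q') : degreeScl g q = degreeScl g q' := by
  have hmk : (Quot.mk _ ⟨q, hq⟩ : Pi0 D') = Quot.mk _ ⟨q', hq'⟩ := Quot.sound h
  by_cases hc : compSub D' D (Quot.mk _ ⟨q, hq⟩)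
  · rw [degreeScl_of_compSub g hq hc, degreeScl_of_compSub g hq' (hmk ▸ hc)]
    exact congrArg g (Subtype.ext hmk)
  · have hc' : ¬ compSub D' D (Quot.mk _ ⟨q', hq'⟩) := hmk ▸ hc
    rw [degreeScl, dif_neg fun h => hc h.2, degreeScl, dif_neg fun h => hc' h.2]

/-- The homomorphism with prescribed scalars on the components contained in the source. -/
noncomputable def homOfComponentScl [PartialOrder Q] {D D' : Set Q} (hD' : IsLowerSet D')
    (g : {c : Pi0 D' // compSub D' D c} → k) : HomQ k D D' where
  val q := LinearMap.codRestrict _ (degreeScl g q • (cmpt k D q).subtype) fun x =>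
    mem_cmpt_iff.2 fun hq => by simp [degreeScl_of_notMem_right g hq]
  property q q' h := by
    ext x
    simp only [LinearMap.comp_apply, coe_stMap, LinearMap.codRestrict_apply, LinearMap.smul_apply,
      Submodule.subtype_apply, smul_eq_mul]
    by_cases hq' : q' ∈ D'
    · rw [if_pos hq', degreeScl_eq_of_le g (hD' h hq') hq' h]
      by_cases hq'D : q' ∈ D
      · simp [hq'D]
      · simp [degreeScl_of_notMem_left g hq'D]
    · simp [hq', degreeScl_of_notMem_right g hq']

theorem componentSclLinear_surjective [PartialOrder Q] {D D' : Set Q} (hD : IsLowerSet D)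
    (hD' : IsLowerSet D') : Function.Surjective (componentSclLinear (k := k) (D' := D') hD) := by
  intro g
  refine ⟨homOfComponentScl hD' g, ?_⟩
  ext ⟨c, hc⟩
  induction c using Quot.ind with | mk a =>
  have ha := hc a rfl
  simp [componentSclLinear, componentScl, sclExt_of_mem _ ha, scl, homOfComponentScl,
    degreeScl_of_compSub g a.2 hc]

end IndicatorModules

/-- For downsets `D, D'` in a poset `Q`, the space `Hom_Q(k[D], k[D'])` is
isomorphic to the space of `k`-valued functions on the set of connected components of `D'`
contained in `D`; explicitly, every homomorphism acts by a single scalar on each component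
of `D'` contained in `D` and by zero on the components not contained in `D`, and every
such choice of scalars arises from a unique homomorphism. -/
theorem hom_downset_module_downset_module (k : Type) [Field k] (Q : Type) [PartialOrder Q]
    (D D' : Set Q) (hD : IsLowerSet D) (hD' : IsLowerSet D') :
    ∃ e : ↥(HomQ k D D') ≃ₗ[k] ({c : Pi0 D' // compSub D' D c} → k),
      (∀ (φ : ↥(HomQ k D D')) (q : Q) (hq : q ∈ D')
          (hc : compSub D' D (Quot.mk _ ⟨q, hq⟩)),
        scl φ.1 q (hc ⟨q, hq⟩ rfl) = e φ ⟨Quot.mk _ ⟨q, hq⟩, hc⟩) ∧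
      (∀ (φ : ↥(HomQ k D D')) (q : Q) (hq : q ∈ D'),
        ¬ compSub D' D (Quot.mk _ ⟨q, hq⟩) → φ.1 q = 0) := by
  refine ⟨LinearEquiv.ofBijective (componentSclLinear hD)
    ⟨componentSclLinear_injective hD, componentSclLinear_surjective hD hD'⟩, ?_, ?_⟩
  · intro φ q hq hc
    exact (sclExt_of_mem φ.1 (hc ⟨q, hq⟩ rfl)).symm
  · intro φ q hq hc
    exact eq_zero_of_sclExt_eq_zero (componentScl_eq_zero hD φ hc)
end

section
/- Let Q be a poset and Υ a set of upsets of Q. Define a relation on uptight regions by: A ⪯ B whenever a ⪯ b for some a ∈ A and b ∈ B. Then this relation is reflexive, and it is acyclic: whenever A_0 ⪯ A_1 ⪯ ⋯ ⪯ A_m ⪯ A_0 is a cycle of uptight regions, all the regions A_0, A_1, …, A_m are equal. -/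
/-- The uptight regions determined by a set `Υ` of upsets of a poset `Q`: the fibers of
the map sending `a` to the set of members of `Υ` containing `a`. -/
def IsUptightRegion {Q : Type} [PartialOrder Q] (Υ : Set (Set Q)) (A : Set Q) : Prop :=
  ∃ a : Q, A = {b : Q | ∀ U ∈ Υ, a ∈ U ↔ b ∈ U}

/-- The relation on uptight regions: `A ⪯ B` when some `a ∈ A` and `b ∈ B` satisfy
`a ≤ b`. -/
def RegionRel {Q : Type} [PartialOrder Q] (A B : Set Q) : Prop :=
  ∃ a ∈ A, ∃ b ∈ B, a ≤ b

/-- Membership in an upset is constant on an uptight region. -/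
theorem IsUptightRegion.mem_iff_mem {Q : Type} [PartialOrder Q] {Υ : Set (Set Q)} {A : Set Q}
    (hA : IsUptightRegion Υ A) {x y : Q} (hx : x ∈ A) (hy : y ∈ A) {U : Set Q} (hU : U ∈ Υ) :
    x ∈ U ↔ y ∈ U := by
  obtain ⟨a, rfl⟩ := hA
  exact (hx U hU).symm.trans (hy U hU)

theorem IsUptightRegion.nonempty {Q : Type} [PartialOrder Q] {Υ : Set (Set Q)} {A : Set Q}
    (hA : IsUptightRegion Υ A) : A.Nonempty := by
  obtain ⟨a, rfl⟩ := hA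
  exact ⟨a, fun _ _ => Iff.rfl⟩

/-- An uptight region is the fiber through any of its points. -/
theorem IsUptightRegion.eq_fiber {Q : Type} [PartialOrder Q] {Υ : Set (Set Q)} {A : Set Q}
    (hA : IsUptightRegion Υ A) {x : Q} (hx : x ∈ A) :
    A = {b : Q | ∀ U ∈ Υ, x ∈ U ↔ b ∈ U} := by
  obtain ⟨a, rfl⟩ := hA
  ext b
  exact forall₂_congr fun U hU => by rw [hx U hU]

/-- Upsets propagate along the relation on uptight regions. -/
theorem RegionRel.mem_of_mem {Q : Type} [PartialOrder Q] {Υ : Set (Set Q)}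
    (hΥ : ∀ U ∈ Υ, IsUpperSet U) {A B : Set Q} (h : RegionRel A B)
    (hA : IsUptightRegion Υ A) (hB : IsUptightRegion Υ B) {x y : Q} (hx : x ∈ A) (hy : y ∈ B)
    {U : Set Q} (hU : U ∈ Υ) (hxU : x ∈ U) : y ∈ U := by
  obtain ⟨a, ha, b, hb, hab⟩ := h
  exact (hB.mem_iff_mem hb hy hU).1 (hΥ U hU hab ((hA.mem_iff_mem hx ha hU).1 hxU))

/-- For a set `Υ` of upsets of a poset `Q`, the relation on uptight
regions given by `A ⪯ B` iff `a ≤ b` for some `a ∈ A`, `b ∈ B` is reflexive and acyclic: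
any directed cycle of uptight regions consists of a single region. -/
theorem uptight_region_rel_reflexive_acyclic {Q : Type} [PartialOrder Q]
    (Υ : Set (Set Q)) (hΥ : ∀ U ∈ Υ, IsUpperSet U) :
    (∀ A : Set Q, IsUptightRegion Υ A → RegionRel A A) ∧
    (∀ (m : ℕ) (A : ℕ → Set Q),
      (∀ i ≤ m, IsUptightRegion Υ (A i)) →
      (∀ i < m, RegionRel (A i) (A (i + 1))) →
      RegionRel (A m) (A 0) →
      ∀ i ≤ m, A i = A 0) := by
  refine ⟨fun A hA => ?_, fun m A hA hrel hlast i hi => ?_⟩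
  · obtain ⟨a, ha⟩ := hA.nonempty
    exact ⟨a, ha, a, ha, le_rfl⟩
  · have mono : ∀ j ≤ m, ∀ i ≤ j, ∀ x ∈ A i, ∀ y ∈ A j, ∀ U ∈ Υ, x ∈ U → y ∈ U := by
      intro j hj i hij
      induction j, hij using Nat.le_induction with
      | base => exact fun x hx y hy U hU => ((hA i hj).mem_iff_mem hx hy hU).1
      | succ j _ ih =>
        intro x hx y hy U hU hxU
        have hj' : j ≤ m := Nat.le_of_succ_le hj
        obtain ⟨z, hz⟩ := (hA j hj').nonempty
        exact (hrel j hj).mem_of_mem hΥ (hA j hj') (hA (j + 1) hj) hz hy hU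
          (ih hj' x hx z hz U hU hxU)
    obtain ⟨x, hx⟩ := (hA i hi).nonempty
    obtain ⟨y, hy⟩ := (hA 0 m.zero_le).nonempty
    obtain ⟨z, hz⟩ := (hA m le_rfl).nonempty
    rw [(hA i hi).eq_fiber hx, (hA 0 m.zero_le).eq_fiber hy]
    have hxy : ∀ U ∈ Υ, x ∈ U ↔ y ∈ U := fun U hU =>
      ⟨fun h => hlast.mem_of_mem hΥ (hA m le_rfl) (hA 0 m.zero_le) hz hy hU
        (mono m le_rfl i hi x hx z hz U hU h),
        mono i hi 0 i.zero_le y hy x hx U hU⟩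
    ext b
    exact forall₂_congr fun U hU => by rw [hxy U hU]
end

section
/- Let M be a Q-module and fix a constant subdivision of Q subordinate to M. For each constant region I, let U_I = {q ∈ Q : ∃ i ∈ I with i ⪯ q} be the upset generated by I and D_I = {q ∈ Q : ∃ i ∈ I with q ⪯ i} the downset cogenerated by I, and let Υ be the set of all constant upsets, namely all U_I together with all complements Q ∖ D_I. Then the partition of Q into uptight regions for Υ is again a constant subdivision of Q subordinate to M: there exist vector spaces and isomorphisms, one for each uptight region, satisfying the no-monodromy condition. -/
/-- Let `M` be a `Q`-module with a constant subdivision `P` subordinate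
to it (spaces `W A`, isomorphisms `ψ`, no monodromy).  Let `Υ` be the set of constant
upsets: the upsets generated by constant regions together with the complements of the
downsets cogenerated by constant regions.  Then the partition `P'` of `Q` into uptight
regions for `Υ` is again a constant subdivision subordinate to `M`: there exist vector
spaces `V' A` and isomorphisms `φ' A q : V' A ≃ M q` satisfying no monodromy. -/
theorem uptight_regions_form_constant_subdivision
    {k : Type} [Field k] {Q : Type} [PartialOrder Q]
    (M : Q → Type) [∀ q, AddCommGroup (M q)] [∀ q, Module k (M q)]
    (f : ∀ {q q' : Q}, q ≤ q' → (M q →ₗ[k] M q'))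
    (f_id : ∀ q : Q, f (le_refl q) = LinearMap.id)
    (f_comp : ∀ {q q' q'' : Q} (h : q ≤ q') (h' : q' ≤ q''),
      f h' ∘ₗ f h = f (h.trans h'))
    (P : Set (Set Q))
    (hcover : ∀ q : Q, ∃ A ∈ P, q ∈ A)
    (hdisj : ∀ A ∈ P, ∀ B ∈ P, (A ∩ B).Nonempty → A = B)
    (W : Set Q → Type) [∀ A, AddCommGroup (W A)] [∀ A, Module k (W A)]
    (ψ : ∀ A ∈ P, ∀ q ∈ A, W A ≃ₗ[k] M q)
    (no_monodromy : ∀ A (hA : A ∈ P) B (hB : B ∈ P),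
      ∀ i i' j j' (hi : i ∈ A) (hi' : i' ∈ A) (hj : j ∈ B) (hj' : j' ∈ B)
        (h : i ≤ j) (h' : i' ≤ j'),
        (ψ B hB j hj).symm.toLinearMap ∘ₗ f h ∘ₗ (ψ A hA i hi).toLinearMap
          = (ψ B hB j' hj').symm.toLinearMap ∘ₗ f h' ∘ₗ (ψ A hA i' hi').toLinearMap) :
    -- the constant upsets and the associated uptight regions
    let upGen : Set Q → Set Q := fun A => {q : Q | ∃ i ∈ A, i ≤ q}
    let downGen : Set Q → Set Q := fun A => {q : Q | ∃ i ∈ A, q ≤ i}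
    let Υ : Set (Set Q) :=
      {S : Set Q | (∃ A ∈ P, S = upGen A) ∨ (∃ A ∈ P, S = (downGen A)ᶜ)}
    let P' : Set (Set Q) := {A : Set Q | ∃ a : Q, A = {b : Q | ∀ U ∈ Υ, a ∈ U ↔ b ∈ U}}
    ∃ (V' : Set Q → ModuleCat.{0} k)
      (φ' : ∀ A ∈ P', ∀ q ∈ A, ↥(V' A) ≃ₗ[k] M q),
      ∀ A (hA : A ∈ P') B (hB : B ∈ P'),
        ∀ i i' j j' (hi : i ∈ A) (hi' : i' ∈ A) (hj : j ∈ B) (hj' : j' ∈ B)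
          (h : i ≤ j) (h' : i' ≤ j'),
          (φ' B hB j hj).symm.toLinearMap ∘ₗ f h ∘ₗ (φ' A hA i hi).toLinearMap
            = (φ' B hB j' hj').symm.toLinearMap ∘ₗ f h' ∘ₗ (φ' A hA i' hi').toLinearMap := by
  have f_comp_apply {q q' q'' : Q} (h : q ≤ q') (h' : q' ≤ q'') (x : M q) :
      f h' (f h x) = f (h.trans h') x := LinearMap.congr_fun (f_comp h h') x
  have transport {A : Set Q} (hA : A ∈ P) {i j : Q} (hi : i ∈ A) (hj : j ∈ A) (h : i ≤ j)
      (w : W A) : (ψ A hA j hj).symm (f h (ψ A hA i hi w)) = w := by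
    simpa [f_id] using
      LinearMap.congr_fun (no_monodromy A hA A hA i i j i hi hi hj hi h le_rfl) w
  -- If `q` lies between elements of `A`, and `a ∈ A` between elements of the region of `q`,
  -- then `M q` is isomorphic to `W A` along the structure maps.
  have exists_equiv {A : Set Q} (hA : A ∈ P) {B : Set Q} (hB : B ∈ P) {a q : Q} (ha : a ∈ A)
      (hq : q ∈ B) (hqA : ∃ i ∈ A, i ≤ q) (hqA' : ∃ j ∈ A, q ≤ j)
      (haB : ∃ i ∈ B, i ≤ a) (haB' : ∃ j ∈ B, a ≤ j) :
      ∃ e : W A ≃ₗ[k] M q,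
        (∃ i, ∃ hi : i ∈ A, ∃ h : i ≤ q, ∀ w, e w = f h (ψ A hA i hi w)) ∧
        (∃ j, ∃ hj : j ∈ A, ∃ h : q ≤ j, ∀ x, e.symm x = (ψ A hA j hj).symm (f h x)) := by
    obtain ⟨i, hi, hiq⟩ := hqA
    obtain ⟨j, hj, hqj⟩ := hqA'
    obtain ⟨b, hb, hba⟩ := haB
    obtain ⟨c, hc, hac⟩ := haB'
    let g : W A →ₗ[k] M q := f hiq ∘ₗ (ψ A hA i hi).toLinearMap
    let r : M q →ₗ[k] W A := (ψ A hA j hj).symm.toLinearMap ∘ₗ f hqj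
    have hrg (w : W A) : r (g w) = w := by
      simp only [r, g, LinearMap.comp_apply, LinearEquiv.coe_coe, f_comp_apply]
      exact transport hA hi hj _ w
    have hr : Function.Injective r := by
      have key (w : W B) : r (ψ B hB q hq w) = (ψ A hA a ha).symm (f hba (ψ B hB b hb w)) :=
        LinearMap.congr_fun (no_monodromy B hB A hA q b j a hq hb hj ha hqj hba) w
      intro x y hxy
      obtain ⟨w, rfl⟩ := (ψ B hB q hq).surjective x
      obtain ⟨v, rfl⟩ := (ψ B hB q hq).surjective y
      rw [key, key] at hxy
      have hf := congrArg (f hac) ((ψ A hA a ha).symm.injective hxy)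
      rw [f_comp_apply, f_comp_apply] at hf
      rw [← transport hB hb hc (hba.trans hac) w, hf, transport hB hb hc]
    exact ⟨LinearEquiv.ofLinearMap g r (LinearMap.ext fun x => hr (hrg (r x)))
      (LinearMap.ext hrg), ⟨i, hi, hiq, fun _ => rfl⟩, ⟨j, hj, hqj, fun _ => rfl⟩⟩
  intro upGen downGen Υ P'
  choose reg hreg mem_reg using hcover
  have uptight {A : Set Q} (hA : A ∈ P') {a b : Q} (ha : a ∈ A) (hb : b ∈ A) :
      (∃ i ∈ reg a, i ≤ b) ∧ ∃ j ∈ reg a, b ≤ j := by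
    obtain ⟨c, rfl⟩ := hA
    have hab (U : Set Q) (hU : U ∈ Υ) : a ∈ U ↔ b ∈ U := (ha U hU).symm.trans (hb U hU)
    exact ⟨(hab (upGen (reg a)) (Or.inl ⟨_, hreg a, rfl⟩)).1 ⟨a, mem_reg a, le_rfl⟩,
      (not_iff_not.1 (hab (downGen (reg a))ᶜ (Or.inr ⟨_, hreg a, rfl⟩))).1
        ⟨a, mem_reg a, le_rfl⟩⟩
  classical
  let R : Set Q → Set Q := fun A => if h : A.Nonempty then reg h.some else ∅
  have hR {A : Set Q} (h : A.Nonempty) : R A = reg h.some := dif_pos h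
  have R_mem {A : Set Q} (h : A.Nonempty) : R A ∈ P := hR h ▸ hreg h.some
  have exists_equiv_R (A : Set Q) (hA : A ∈ P') (q : Q) (hq : q ∈ A) :
      ∃ e : W (R A) ≃ₗ[k] M q,
        (∃ i, ∃ hi : i ∈ R A, ∃ h : i ≤ q,
          ∀ w, e w = f h (ψ (R A) (R_mem ⟨q, hq⟩) i hi w)) ∧
        (∃ j, ∃ hj : j ∈ R A, ∃ h : q ≤ j,
          ∀ x, e.symm x = (ψ (R A) (R_mem ⟨q, hq⟩) j hj).symm (f h x)) :=
    have h : A.Nonempty := ⟨q, hq⟩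
    exists_equiv (R_mem h) (hreg q) (a := h.some) (hR h ▸ mem_reg h.some) (mem_reg q)
      (hR h ▸ (uptight hA h.some_mem hq).1) (hR h ▸ (uptight hA h.some_mem hq).2)
      (uptight hA hq h.some_mem).1 (uptight hA hq h.some_mem).2
  choose e he he' using exists_equiv_R
  refine ⟨fun A => ModuleCat.of k (W (R A)), e, ?_⟩
  intro A hA B hB i i' j j' hi hi' hj hj' h h'
  obtain ⟨p, hp, hpi, ep⟩ := he A hA i hi
  obtain ⟨p', hp', hpi', ep'⟩ := he A hA i' hi'
  obtain ⟨q, hq, hjq, eq⟩ := he' B hB j hj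
  obtain ⟨q', hq', hjq', eq'⟩ := he' B hB j' hj'
  refine LinearMap.ext fun w => ?_
  change (e B hB j hj).symm (f h (e A hA i hi w)) =
    (e B hB j' hj').symm (f h' (e A hA i' hi' w))
  rw [ep, ep', eq, eq', f_comp_apply, f_comp_apply, f_comp_apply, f_comp_apply]
  exact LinearMap.congr_fun (no_monodromy _ (R_mem ⟨i, hi⟩) _ (R_mem ⟨j, hj⟩) p p' q q'
    hp hp' hq hq' _ _) w
end

section
/- Let Q be a poset and M a Q-finite Q-module (every component M_q is finite-dimensional over k). Then M admits a finite encoding if and only if there exists a finite constant subdivision of Q subordinate to M (one with finitely many constant regions). -/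
namespace PosetModule

section FiberSubdivision

variable {k : Type} [Field k] {P : Type} [PartialOrder P] {H : P → ModuleCat.{0} k}
  (g : ∀ {p p' : P}, p ≤ p' → (↥(H p) →ₗ[k] ↥(H p')))
  (g_id : ∀ p : P, g (le_refl p) = LinearMap.id)
  (g_comp : ∀ {p p' p'' : P} (h : p ≤ p') (h' : p' ≤ p''), g h' ∘ₗ g h = g (h.trans h'))

/-- The structure map of a module over a poset along an equality, as an equivalence. -/
def transport {p p' : P} (h : p = p') : ↥(H p) ≃ₗ[k] ↥(H p') :=
  LinearEquiv.ofLinearMap (g h.le) (g h.ge)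
    (by rw [g_comp, ← g_id]) (by rw [g_comp, ← g_id])

/-- Conjugating the structure maps of a module by an encoding gives maps which depend only on
the classes of the source and target. -/
theorem transport_symm_comp {Q : Type} [PartialOrder Q]
    {M : Q → Type} [∀ q, AddCommGroup (M q)] [∀ q, Module k (M q)]
    {f : ∀ {q q' : Q}, q ≤ q' → (M q →ₗ[k] M q')}
    {π : Q → P} (hπ : Monotone π) (e : ∀ q : Q, M q ≃ₗ[k] ↥(H (π q)))
    (he : ∀ (q q' : Q) (h : q ≤ q'),
      (e q').toLinearMap ∘ₗ f h = g (hπ h) ∘ₗ (e q).toLinearMap)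
    {p p' : P} {i j : Q} (hi : p = π i) (hj : p' = π j) (h : i ≤ j) :
    ((transport g g_id g_comp hj).trans (e j).symm).symm.toLinearMap ∘ₗ f h ∘ₗ
      ((transport g g_id g_comp hi).trans (e i).symm).toLinearMap
        = g (hi.le.trans ((hπ h).trans hj.ge)) := by
  rw [← g_comp hi.le ((hπ h).trans hj.ge), ← g_comp (hπ h) hj.ge]
  ext x
  have := LinearMap.congr_fun (he i j h) ((e i).symm (g hi.le x))
  simp only [LinearMap.comp_apply, LinearEquiv.coe_coe, LinearEquiv.apply_symm_apply] at this
  simp [transport, this]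

end FiberSubdivision

section Regions

variable {k : Type} [Field k] {Q : Type} [PartialOrder Q]
  {M : Q → Type} [∀ q, AddCommGroup (M q)] [∀ q, Module k (M q)]

/-- The set of regions meeting the principal downset of `q`, together with the set of regions
meeting the principal upset of `q`, the latter ordered by reverse inclusion. -/
def regionType (P : Set (Set Q)) (q : Q) : Set P × (Set P)ᵒᵈ :=
  (fun A => ∃ a ∈ A.1, a ≤ q, OrderDual.toDual fun A => ∃ a ∈ A.1, q ≤ a)

theorem regionType_monotone (P : Set (Set Q)) : Monotone (regionType P) := fun _ _ h =>
  ⟨fun _ ⟨a, ha, hq⟩ => ⟨a, ha, hq.trans h⟩, fun _ ⟨a, ha, hq⟩ => ⟨a, ha, h.trans hq⟩⟩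

theorem exists_le_of_regionType_le {P : Set (Set Q)} {A : Set Q} (hA : A ∈ P) {i j : Q}
    (hi : i ∈ A) (h : regionType P i ≤ regionType P j) : ∃ a ∈ A, a ≤ j :=
  h.1 (show (⟨A, hA⟩ : P) ∈ (regionType P i).1 from ⟨i, hi, le_rfl⟩)

theorem exists_ge_of_regionType_le {P : Set (Set Q)} {B : Set Q} (hB : B ∈ P) {i j : Q}
    (hj : j ∈ B) (h : regionType P i ≤ regionType P j) : ∃ b ∈ B, i ≤ b :=
  h.2 (show (⟨B, hB⟩ : P) ∈ OrderDual.ofDual (regionType P j).2 from ⟨j, hj, le_rfl⟩)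

variable (f : ∀ {q q' : Q}, q ≤ q' → (M q →ₗ[k] M q'))
  {P : Set (Set Q)} {W : Set Q → ModuleCat.{0} k} (ψ : ∀ A ∈ P, ∀ q ∈ A, ↥(W A) ≃ₗ[k] M q)

/-- The map between the vector spaces of two regions which is induced by every comparable pair
of elements, or an unspecified map when there is no such map. -/
noncomputable def regionMap (A B : Set Q) : ↥(W A) →ₗ[k] ↥(W B) :=
  Classical.epsilon fun L => ∀ (hA : A ∈ P) (hB : B ∈ P) (i j : Q) (hi : i ∈ A) (hj : j ∈ B)
    (h : i ≤ j),
      L = (ψ B hB j hj).symm.toLinearMap ∘ₗ f h ∘ₗ (ψ A hA i hi).toLinearMap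

/-- All comparable pairs of elements of two regions induce the same map. -/
def NoMonodromy : Prop :=
  ∀ A (hA : A ∈ P) B (hB : B ∈ P),
    ∀ i i' j j' (hi : i ∈ A) (hi' : i' ∈ A) (hj : j ∈ B) (hj' : j' ∈ B)
      (h : i ≤ j) (h' : i' ≤ j'),
      (ψ B hB j hj).symm.toLinearMap ∘ₗ f h ∘ₗ (ψ A hA i hi).toLinearMap
        = (ψ B hB j' hj').symm.toLinearMap ∘ₗ f h' ∘ₗ (ψ A hA i' hi').toLinearMap

variable {f ψ}

theorem regionMap_eq (hψ : NoMonodromy f ψ) {A B : Set Q} (hA : A ∈ P) (hB : B ∈ P) {i j : Q}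
    (hi : i ∈ A) (hj : j ∈ B) (h : i ≤ j) :
    regionMap f ψ A B = (ψ B hB j hj).symm.toLinearMap ∘ₗ f h ∘ₗ (ψ A hA i hi).toLinearMap :=
  Classical.epsilon_spec (p := fun L => ∀ (hA : A ∈ P) (hB : B ∈ P) (i j : Q) (hi : i ∈ A)
      (hj : j ∈ B) (h : i ≤ j),
        L = (ψ B hB j hj).symm.toLinearMap ∘ₗ f h ∘ₗ (ψ A hA i hi).toLinearMap)
    ⟨_, fun _ _ _ _ hi' hj' h' => hψ A hA B hB i _ j _ hi hi' hj hj' h h'⟩ hA hB i j hi hj h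

theorem regionMap_self (f_id : ∀ q : Q, f (le_refl q) = LinearMap.id)
    (hψ : NoMonodromy f ψ) {A : Set Q} (hA : A ∈ P) {i : Q} (hi : i ∈ A) :
    regionMap f ψ A A = LinearMap.id := by
  rw [regionMap_eq hψ hA hA hi hi le_rfl, f_id]
  ext x
  simp

theorem regionMap_comp
    (f_comp : ∀ {q q' q'' : Q} (h : q ≤ q') (h' : q' ≤ q''), f h' ∘ₗ f h = f (h.trans h'))
    (hψ : NoMonodromy f ψ) {A B C : Set Q} (hA : A ∈ P) (hB : B ∈ P) (hC : C ∈ P) {i j l : Q}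
    (hi : i ∈ A) (hj : j ∈ B) (hl : l ∈ C)
    (hij : regionType P i ≤ regionType P j) (hjl : regionType P j ≤ regionType P l) :
    regionMap f ψ B C ∘ₗ regionMap f ψ A B = regionMap f ψ A C := by
  obtain ⟨a, ha, haj⟩ := exists_le_of_regionType_le hA hi hij
  obtain ⟨c, hc, hjc⟩ := exists_ge_of_regionType_le hC hl hjl
  rw [regionMap_eq hψ hA hB ha hj haj, regionMap_eq hψ hB hC hj hc hjc,
    regionMap_eq hψ hA hC ha hc (haj.trans hjc), ← f_comp haj hjc]
  ext x
  simp

end Regions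

end PosetModule

open PosetModule

/-- Let `Q` be a poset and `M` a `Q`-finite `Q`-module (all components
finite-dimensional over `k`).  Then `M` admits a finite encoding — a monotone map
`π : Q → P` to a finite poset `P` together with a `P`-module `H` with finite-dimensional
components whose pullback along `π` is isomorphic to `M` — if and only if there exists a
finite constant subdivision of `Q` subordinate to `M`. -/
theorem finite_encoding_iff_finite_constant_subdivision
    {k : Type} [Field k] {Q : Type} [PartialOrder Q]
    (M : Q → Type) [∀ q, AddCommGroup (M q)] [∀ q, Module k (M q)]
    (f : ∀ {q q' : Q}, q ≤ q' → (M q →ₗ[k] M q'))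
    (f_id : ∀ q : Q, f (le_refl q) = LinearMap.id)
    (f_comp : ∀ {q q' q'' : Q} (h : q ≤ q') (h' : q' ≤ q''),
      f h' ∘ₗ f h = f (h.trans h'))
    (hfin : ∀ q : Q, FiniteDimensional k (M q)) :
    -- finite encoding of M
    (∃ (P : Type) (_ : PartialOrder P) (_ : Finite P) (π : Q → P) (hπ : Monotone π)
       (H : P → ModuleCat.{0} k)
       (g : ∀ {p p' : P}, p ≤ p' → (↥(H p) →ₗ[k] ↥(H p'))),
       (∀ p : P, g (le_refl p) = LinearMap.id) ∧
       (∀ {p p' p'' : P} (h : p ≤ p') (h' : p' ≤ p''), g h' ∘ₗ g h = g (h.trans h')) ∧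
       (∀ p : P, FiniteDimensional k ↥(H p)) ∧
       ∃ e : ∀ q : Q, M q ≃ₗ[k] ↥(H (π q)),
         ∀ (q q' : Q) (h : q ≤ q'),
           (e q').toLinearMap ∘ₗ f h = g (hπ h) ∘ₗ (e q).toLinearMap)
    ↔
    -- finite constant subdivision subordinate to M
    (∃ P : Set (Set Q),
       (∀ q : Q, ∃ A ∈ P, q ∈ A) ∧
       (∀ A ∈ P, ∀ B ∈ P, (A ∩ B).Nonempty → A = B) ∧
       P.Finite ∧
       ∃ (W : Set Q → ModuleCat.{0} k)
         (ψ : ∀ A ∈ P, ∀ q ∈ A, ↥(W A) ≃ₗ[k] M q),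
         ∀ A (hA : A ∈ P) B (hB : B ∈ P),
           ∀ i i' j j' (hi : i ∈ A) (hi' : i' ∈ A) (hj : j ∈ B) (hj' : j' ∈ B)
             (h : i ≤ j) (h' : i' ≤ j'),
             (ψ B hB j hj).symm.toLinearMap ∘ₗ f h ∘ₗ (ψ A hA i hi).toLinearMap
               = (ψ B hB j' hj').symm.toLinearMap ∘ₗ f h' ∘ₗ (ψ A hA i' hi').toLinearMap) := by
  constructor
  · rintro ⟨P, _, _, π, hπ, H, g, g_id, g_comp, -, e, he⟩
    rcases isEmpty_or_nonempty Q with _ | _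
    · exact ⟨∅, fun q => isEmptyElim q, by simp, Set.finite_empty,
        fun _ => ModuleCat.of k PUnit, fun _ h => h.elim, fun _ h => h.elim⟩
    have base : ∀ A ∈ Set.range fun p : P => π ⁻¹' {p}, ∀ q ∈ A,
        π (Classical.epsilon (· ∈ A)) = π q := by
      rintro _ ⟨p, rfl⟩ q hq
      have : Classical.epsilon (· ∈ π ⁻¹' {p}) ∈ π ⁻¹' {p} := Classical.epsilon_spec ⟨q, hq⟩
      exact this.trans hq.symm
    refine ⟨Set.range fun p : P => π ⁻¹' {p}, fun q => ⟨_, ⟨π q, rfl⟩, rfl⟩, ?_,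
      Set.finite_range _, fun A => H (π (Classical.epsilon (· ∈ A))),
      fun A hA q hq => (transport g g_id g_comp (base A hA q hq)).trans (e q).symm, ?_⟩
    · rintro _ ⟨p, rfl⟩ _ ⟨p', rfl⟩ ⟨q, hq, hq'⟩
      obtain rfl : p = p' := hq.symm.trans hq'
      rfl
    · intro A hA B hB i i' j j' hi hi' hj hj' h h'
      exact (transport_symm_comp g g_id g_comp hπ e he _ _ h).trans
        (transport_symm_comp g g_id g_comp hπ e he _ _ h').symm
  · rintro ⟨P, cover, -, hP, W, ψ, hψ⟩
    have hψ : NoMonodromy f ψ := hψ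
    have := hP.to_subtype
    have : Finite (Set P)ᵒᵈ := inferInstanceAs (Finite (Set P))
    choose R hR mem using cover
    choose r hr using fun p : Set.range (regionType P) => p.2
    have hr' : ∀ q, regionType P (r ⟨regionType P q, q, rfl⟩) = regionType P q := fun q => hr _
    have le_r : ∀ {p p' : Set.range (regionType P)}, p ≤ p' →
        regionType P (r p) ≤ regionType P (r p') := fun h => by
      rw [hr, hr]
      exact h
    have comp : ∀ {i j l : Q}, regionType P i ≤ regionType P j →
        regionType P j ≤ regionType P l →
        regionMap f ψ (R j) (R l) ∘ₗ regionMap f ψ (R i) (R j) = regionMap f ψ (R i) (R l) :=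
      regionMap_comp f_comp hψ (hR _) (hR _) (hR _) (mem _) (mem _) (mem _)
    have self : ∀ q, regionMap f ψ (R q) (R q) = LinearMap.id := fun q =>
      regionMap_self f_id hψ (hR q) (mem q)
    let iso (q : Q) : ↥(W (R q)) ≃ₗ[k] ↥(W (R (r ⟨regionType P q, q, rfl⟩))) :=
      LinearEquiv.ofLinearMap (regionMap f ψ _ _) (regionMap f ψ _ _)
        ((comp (hr' q).le (hr' q).ge).trans (self _))
        ((comp (hr' q).ge (hr' q).le).trans (self _))
    refine ⟨Set.range (regionType P), inferInstance, inferInstance, fun q => ⟨_, q, rfl⟩,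
      fun _ _ h => regionType_monotone P h, fun p => W (R (r p)),
      fun {p p'} _ => regionMap f ψ (R (r p)) (R (r p')), fun p => self _,
      fun h h' => comp (le_r h) (le_r h'), fun p => ?_,
      fun q => (ψ _ (hR q) q (mem q)).symm.trans (iso q), ?_⟩
    · have := hfin (r p)
      exact (ψ _ (hR (r p)) _ (mem _)).symm.finiteDimensional
    · intro q q' h
      have hq := regionType_monotone P h
      have key := (comp hq (hr' q').ge).trans
        (comp (hr' q).ge ((hr' q).le.trans (hq.trans (hr' q').ge))).symm
      rw [regionMap_eq hψ (hR q) (hR q') (mem q) (mem q') h] at key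
      ext x
      have := LinearMap.congr_fun key ((ψ _ (hR q) q (mem q)).symm x)
      simpa [iso] using this
end

section
/- Let φ : M → N be a tame homomorphism of Q-modules. Then the kernel ker φ (the Q-module with (ker φ)_q = ker(φ_q) and restricted structure maps) and the cokernel coker φ (with (coker φ)_q = N_q / image(φ_q) and induced structure maps) are tame Q-modules; indeed, any finite constant subdivision witnessing the tameness of φ is subordinate to both ker φ and coker φ. -/
section

variable {k V V' W W' : Type*} [Field k] [AddCommGroup V] [Module k V] [AddCommGroup V']
  [Module k V'] [AddCommGroup W] [Module k W] [AddCommGroup W'] [Module k W']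

theorem LinearMap.map_ker_of_intertwines (f : V →ₗ[k] W) (g : V' →ₗ[k] W')
    (e : V ≃ₗ[k] V') (e' : W ≃ₗ[k] W') (h : ∀ x, g (e x) = e' (f x)) :
    (LinearMap.ker f).map e.toLinearMap = LinearMap.ker g := by
  ext y
  simp only [Submodule.mem_map, LinearMap.mem_ker, LinearEquiv.coe_coe]
  constructor
  · rintro ⟨x, hx, rfl⟩
    rw [h, hx, map_zero]
  · intro hy
    refine ⟨e.symm y, e'.injective ?_, e.apply_symm_apply y⟩
    rw [← h, e.apply_symm_apply, hy, map_zero]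

theorem LinearMap.map_range_of_intertwines (f : V →ₗ[k] W) (g : V' →ₗ[k] W')
    (e : V ≃ₗ[k] V') (e' : W ≃ₗ[k] W') (h : ∀ x, g (e x) = e' (f x)) :
    (LinearMap.range f).map e'.toLinearMap = LinearMap.range g := by
  ext y
  simp only [Submodule.mem_map, LinearMap.mem_range, LinearEquiv.coe_coe]
  constructor
  · rintro ⟨_, ⟨x, rfl⟩, rfl⟩
    exact ⟨e x, h x⟩
  · rintro ⟨x, rfl⟩
    exact ⟨_, ⟨e.symm x, rfl⟩, by rw [← h, e.apply_symm_apply]⟩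

end

/-- A family of linear maps whose conjugates are constant on each region is induced by one linear
map per region. -/
theorem exists_regionwise_linearMap {k Q : Type*} [Field k]
    {M N : Q → Type*} [∀ q, AddCommGroup (M q)] [∀ q, Module k (M q)]
    [∀ q, AddCommGroup (N q)] [∀ q, Module k (N q)] (φ : ∀ q, M q →ₗ[k] N q) (P : Set (Set Q))
    {WM WN : Set Q → Type*} [∀ A, AddCommGroup (WM A)] [∀ A, Module k (WM A)]
    [∀ A, AddCommGroup (WN A)] [∀ A, Module k (WN A)]
    (ψM : ∀ A ∈ P, ∀ q ∈ A, WM A ≃ₗ[k] M q) (ψN : ∀ A ∈ P, ∀ q ∈ A, WN A ≃ₗ[k] N q)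
    (hφconst : ∀ A (hA : A ∈ P), ∀ i i' (hi : i ∈ A) (hi' : i' ∈ A),
      (ψN A hA i hi).symm.toLinearMap ∘ₗ φ i ∘ₗ (ψM A hA i hi).toLinearMap
        = (ψN A hA i' hi').symm.toLinearMap ∘ₗ φ i' ∘ₗ (ψM A hA i' hi').toLinearMap) :
    ∃ Φ : ∀ A, WM A →ₗ[k] WN A, ∀ A (hA : A ∈ P), ∀ i (hi : i ∈ A), ∀ x,
      φ i (ψM A hA i hi x) = ψN A hA i hi (Φ A x) := by
  suffices h : ∀ A, ∃ Φ : WM A →ₗ[k] WN A, ∀ (hA : A ∈ P), ∀ i (hi : i ∈ A), ∀ x,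
      φ i (ψM A hA i hi x) = ψN A hA i hi (Φ x) from ⟨_, fun A => (h A).choose_spec⟩
  intro A
  by_cases hne : A ∈ P ∧ A.Nonempty
  · obtain ⟨hA, i₀, hi₀⟩ := hne
    refine ⟨(ψN A hA i₀ hi₀).symm.toLinearMap ∘ₗ φ i₀ ∘ₗ (ψM A hA i₀ hi₀).toLinearMap,
      fun _ i hi x => ?_⟩
    rw [hφconst A hA i₀ i hi₀ hi]
    simp
  · exact ⟨0, fun hA i hi => absurd ⟨hA, i, hi⟩ hne⟩


/-- Let `φ : M → N` be a tame homomorphism of `Q`-modules, witnessed by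
a finite constant subdivision `P` subordinate to both `M` and `N` (spaces `WM`, `WN`,
isomorphisms `ψM`, `ψN`, no monodromy) on whose regions the conjugated maps
`ψN⁻¹ ∘ φᵢ ∘ ψM` are independent of the chosen point.  Then the kernel and cokernel of
`φ` are tame `Q`-modules; indeed, the same finite constant subdivision `P` is subordinate
to both the kernel and the cokernel. -/
theorem ker_coker_of_tame_hom_are_tame
    {k : Type} [Field k] {Q : Type} [PartialOrder Q]
    (M : Q → Type) [∀ q, AddCommGroup (M q)] [∀ q, Module k (M q)]
    (N : Q → Type) [∀ q, AddCommGroup (N q)] [∀ q, Module k (N q)]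
    (fM : ∀ {q q' : Q}, q ≤ q' → (M q →ₗ[k] M q'))
    (fN : ∀ {q q' : Q}, q ≤ q' → (N q →ₗ[k] N q'))
    (fM_id : ∀ q : Q, fM (le_refl q) = LinearMap.id)
    (fN_id : ∀ q : Q, fN (le_refl q) = LinearMap.id)
    (fM_comp : ∀ {q q' q'' : Q} (h : q ≤ q') (h' : q' ≤ q''),
      fM h' ∘ₗ fM h = fM (h.trans h'))
    (fN_comp : ∀ {q q' q'' : Q} (h : q ≤ q') (h' : q' ≤ q''),
      fN h' ∘ₗ fN h = fN (h.trans h'))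
    (hfinM : ∀ q : Q, FiniteDimensional k (M q))
    (hfinN : ∀ q : Q, FiniteDimensional k (N q))
    (φ : ∀ q : Q, M q →ₗ[k] N q)
    (hφ : ∀ (q q' : Q) (h : q ≤ q'), φ q' ∘ₗ fM h = fN h ∘ₗ φ q)
    (P : Set (Set Q))
    (hcover : ∀ q : Q, ∃ A ∈ P, q ∈ A)
    (hdisj : ∀ A ∈ P, ∀ B ∈ P, (A ∩ B).Nonempty → A = B)
    (hPfin : P.Finite)
    (WM : Set Q → Type) [∀ A, AddCommGroup (WM A)] [∀ A, Module k (WM A)]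
    (WN : Set Q → Type) [∀ A, AddCommGroup (WN A)] [∀ A, Module k (WN A)]
    (ψM : ∀ A ∈ P, ∀ q ∈ A, WM A ≃ₗ[k] M q)
    (ψN : ∀ A ∈ P, ∀ q ∈ A, WN A ≃ₗ[k] N q)
    (noMonM : ∀ A (hA : A ∈ P) B (hB : B ∈ P),
      ∀ i i' j j' (hi : i ∈ A) (hi' : i' ∈ A) (hj : j ∈ B) (hj' : j' ∈ B)
        (h : i ≤ j) (h' : i' ≤ j'),
        (ψM B hB j hj).symm.toLinearMap ∘ₗ fM h ∘ₗ (ψM A hA i hi).toLinearMap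
          = (ψM B hB j' hj').symm.toLinearMap ∘ₗ fM h' ∘ₗ (ψM A hA i' hi').toLinearMap)
    (noMonN : ∀ A (hA : A ∈ P) B (hB : B ∈ P),
      ∀ i i' j j' (hi : i ∈ A) (hi' : i' ∈ A) (hj : j ∈ B) (hj' : j' ∈ B)
        (h : i ≤ j) (h' : i' ≤ j'),
        (ψN B hB j hj).symm.toLinearMap ∘ₗ fN h ∘ₗ (ψN A hA i hi).toLinearMap
          = (ψN B hB j' hj').symm.toLinearMap ∘ₗ fN h' ∘ₗ (ψN A hA i' hi').toLinearMap)
    (hφconst : ∀ A (hA : A ∈ P), ∀ i i' (hi : i ∈ A) (hi' : i' ∈ A),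
      (ψN A hA i hi).symm.toLinearMap ∘ₗ φ i ∘ₗ (ψM A hA i hi).toLinearMap
        = (ψN A hA i' hi').symm.toLinearMap ∘ₗ φ i' ∘ₗ (ψM A hA i' hi').toLinearMap) :
    -- the kernel and cokernel `Q`-modules
    let kerMap : ∀ {q q' : Q}, q ≤ q' →
        (↥(LinearMap.ker (φ q)) →ₗ[k] ↥(LinearMap.ker (φ q'))) :=
      fun {q q'} h => (fM h).restrict (fun x hx => by
        have hc := LinearMap.congr_fun (hφ q q' h) x
        simp only [LinearMap.comp_apply] at hc
        simp only [LinearMap.mem_ker] at hx ⊢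
        rw [hc, hx, map_zero])
    let cokerMap : ∀ {q q' : Q}, q ≤ q' →
        ((N q ⧸ LinearMap.range (φ q)) →ₗ[k] (N q' ⧸ LinearMap.range (φ q'))) :=
      fun {q q'} h => Submodule.mapQ _ _ (fN h) (by
        intro x hx
        obtain ⟨y, hy⟩ := hx
        have hc := LinearMap.congr_fun (hφ q q' h) y
        simp only [LinearMap.comp_apply] at hc
        simp only [Submodule.mem_comap]
        exact ⟨fM h y, by rw [hc, hy]⟩)
    (∀ q : Q, FiniteDimensional k ↥(LinearMap.ker (φ q))) ∧
    (∀ q : Q, FiniteDimensional k (N q ⧸ LinearMap.range (φ q))) ∧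
    (∃ (VK : Set Q → ModuleCat.{0} k)
       (ψK : ∀ A ∈ P, ∀ q ∈ A, ↥(VK A) ≃ₗ[k] ↥(LinearMap.ker (φ q))),
       ∀ A (hA : A ∈ P) B (hB : B ∈ P),
         ∀ i i' j j' (hi : i ∈ A) (hi' : i' ∈ A) (hj : j ∈ B) (hj' : j' ∈ B)
           (h : i ≤ j) (h' : i' ≤ j'),
           (ψK B hB j hj).symm.toLinearMap ∘ₗ kerMap h ∘ₗ (ψK A hA i hi).toLinearMap
             = (ψK B hB j' hj').symm.toLinearMap ∘ₗ kerMap h' ∘ₗ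
               (ψK A hA i' hi').toLinearMap) ∧
    (∃ (VC : Set Q → ModuleCat.{0} k)
       (ψC : ∀ A ∈ P, ∀ q ∈ A, ↥(VC A) ≃ₗ[k] (N q ⧸ LinearMap.range (φ q))),
       ∀ A (hA : A ∈ P) B (hB : B ∈ P),
         ∀ i i' j j' (hi : i ∈ A) (hi' : i' ∈ A) (hj : j ∈ B) (hj' : j' ∈ B)
           (h : i ≤ j) (h' : i' ≤ j'),
           (ψC B hB j hj).symm.toLinearMap ∘ₗ cokerMap h ∘ₗ (ψC A hA i hi).toLinearMap
             = (ψC B hB j' hj').symm.toLinearMap ∘ₗ cokerMap h' ∘ₗ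
               (ψC A hA i' hi').toLinearMap) := by
  intro kerMap cokerMap
  obtain ⟨Φ, hΦ⟩ := exists_regionwise_linearMap φ P ψM ψN hφconst
  refine ⟨fun q => inferInstance, fun q => inferInstance,
    ⟨fun A => ModuleCat.of k (LinearMap.ker (Φ A)),
      fun A hA q hq => (ψM A hA q hq).ofSubmodules _ _
        (LinearMap.map_ker_of_intertwines _ _ _ _ (hΦ A hA q hq)), ?_⟩,
    ⟨fun A => ModuleCat.of k (WN A ⧸ LinearMap.range (Φ A)),
      fun A hA q hq => Submodule.Quotient.equiv _ _ (ψN A hA q hq)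
        (LinearMap.map_range_of_intertwines _ _ _ _ (hΦ A hA q hq)), ?_⟩⟩
  · intro A hA B hB i i' j j' hi hi' hj hj' h h'
    ext x
    exact LinearMap.congr_fun (noMonM A hA B hB i i' j j' hi hi' hj hj' h h') x.1
  · intro A hA B hB i i' j j' hi hi' hj hj' h h'
    apply LinearMap.ext
    intro x
    obtain ⟨y, rfl⟩ := Submodule.mkQ_surjective (LinearMap.range (Φ A)) x
    exact congrArg (Submodule.mkQ (LinearMap.range (Φ B)))
      (LinearMap.congr_fun (noMonN A hA B hB i i' j j' hi hi' hj hj' h h') y)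
end

section
/- A Z^n-module N is finitely determined if and only if there exists an exact sequence of Z^n-modules 0 → N → E^0 → E^1 → ⋯ → E^ℓ → 0 for some ℓ ≥ 0 in which each E^i is a finite direct sum of downset modules of the form k[b + Zτ − N^n] with b ∈ Z^n and τ a face of N^n. Moreover, when N is finitely determined, such an exact sequence exists with ℓ ≤ n. -/
open Pointwise

/-- `ℤτ ⊆ ℤⁿ`: the subgroup generated by the standard basis vectors indexed by the face
`τ ⊆ {1, …, n}`. -/
def ZTau (n : ℕ) (τ : Set (Fin n)) : Set (Fin n → ℤ) := {z | ∀ i, i ∉ τ → z i = 0}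

/-- `ℕⁿ ⊆ ℤⁿ`: the positive cone of componentwise nonnegative vectors. -/
def NNn (n : ℕ) : Set (Fin n → ℤ) := {m | 0 ≤ m}

/-- The downset `b + ℤτ − ℕⁿ` of `ℤⁿ`. -/
def downInj {n : ℕ} (b : Fin n → ℤ) (τ : Set (Fin n)) : Set (Fin n → ℤ) :=
  ({b} : Set (Fin n → ℤ)) + ZTau n τ - NNn n

/-- The degree-`q` component of a finite direct sum of downset modules
`k[b j + ℤ(τ j) − ℕⁿ]`, `j = 1, …, m`. -/
noncomputable abbrev DSum (k : Type) [Field k] {n : ℕ} (m : ℕ)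
    (b : Fin m → (Fin n → ℤ)) (τ : Fin m → Set (Fin n)) (q : Fin n → ℤ) : Type :=
  ∀ j : Fin m, ↥(cmpt k (downInj (b j) (τ j)) q)

/-- The structure map of a finite direct sum of downset modules. -/
noncomputable def DSumMap (k : Type) [Field k] {n : ℕ} (m : ℕ)
    (b : Fin m → (Fin n → ℤ)) (τ : Fin m → Set (Fin n))
    {q q' : Fin n → ℤ} (h : q ≤ q') :
    DSum k m b τ q →ₗ[k] DSum k m b τ q' :=
  LinearMap.pi fun j => (stMap k (downInj (b j) (τ j)) h) ∘ₗ LinearMap.proj j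

/-- A `ℤⁿ`-module `N` is finitely determined if its components are finite-dimensional and
for each coordinate `i` the structure maps `N_b → N_{b + eᵢ}` are isomorphisms whenever
the `i`-th coordinate of `b` lies outside a bounded interval. -/
def FinDet (k : Type) [Field k] {n : ℕ}
    (N : (Fin n → ℤ) → Type) [∀ a, AddCommGroup (N a)] [∀ a, Module k (N a)]
    (f : ∀ {a b : Fin n → ℤ}, a ≤ b → (N a →ₗ[k] N b)) : Prop :=
  (∀ a, FiniteDimensional k (N a)) ∧
  ∀ i : Fin n, ∃ c : ℤ, ∀ b : Fin n → ℤ, c < |b i| →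
    Function.Bijective
      (f (le_add_of_nonneg_right (Pi.single_nonneg.mpr zero_le_one)) :
        N b →ₗ[k] N (b + Pi.single i 1))

/-- `N` admits an exact sequence `0 → N → E⁰ → E¹ → ⋯ → E^ℓ → 0` of `ℤⁿ`-modules in which
each `Eⁱ` is a finite direct sum of downset modules `k[b + ℤτ − ℕⁿ]` (the modules with
index `> ℓ` being zero, i.e. empty direct sums). -/
def HasFiniteDownsetResolution (k : Type) [Field k] {n : ℕ}
    (N : (Fin n → ℤ) → Type) [∀ a, AddCommGroup (N a)] [∀ a, Module k (N a)]
    (f : ∀ {a b : Fin n → ℤ}, a ≤ b → (N a →ₗ[k] N b)) (ℓ : ℕ) : Prop :=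
  ∃ (m : ℕ → ℕ) (b : ∀ i : ℕ, Fin (m i) → (Fin n → ℤ))
    (τ : ∀ i : ℕ, Fin (m i) → Set (Fin n)),
    (∀ i : ℕ, ℓ < i → m i = 0) ∧
    ∃ (ε : ∀ q : Fin n → ℤ, N q →ₗ[k] DSum k (m 0) (b 0) (τ 0) q)
      (δ : ∀ (i : ℕ) (q : Fin n → ℤ),
        DSum k (m i) (b i) (τ i) q →ₗ[k] DSum k (m (i+1)) (b (i+1)) (τ (i+1)) q),
      (∀ (q q' : Fin n → ℤ) (h : q ≤ q'),
        DSumMap k (m 0) (b 0) (τ 0) h ∘ₗ ε q = ε q' ∘ₗ f h) ∧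
      (∀ (i : ℕ) (q q' : Fin n → ℤ) (h : q ≤ q'),
        DSumMap k (m (i+1)) (b (i+1)) (τ (i+1)) h ∘ₗ δ i q
          = δ i q' ∘ₗ DSumMap k (m i) (b i) (τ i) h) ∧
      (∀ q : Fin n → ℤ, Function.Injective (ε q)) ∧
      (∀ q : Fin n → ℤ, LinearMap.range (ε q) = LinearMap.ker (δ 0 q)) ∧
      (∀ (i : ℕ) (q : Fin n → ℤ),
        LinearMap.range (δ i q) = LinearMap.ker (δ (i+1) q))

/-- A representation of a preorder `P` over `k`: a functor from `P` to `k`-vector spaces. -/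
structure PRep (k : Type) [Field k] (P : Type) [Preorder P] where
  X : P → Type
  [acg : ∀ p, AddCommGroup (X p)]
  [mod : ∀ p, Module k (X p)]
  map : ∀ {p q : P}, p ≤ q → (X p →ₗ[k] X q)
  map_refl : ∀ (p : P) (x : X p), map (le_refl p) x = x
  map_map : ∀ {p q r : P} (h : p ≤ q) (h' : q ≤ r) (x : X p),
    map h' (map h x) = map (h.trans h') x

namespace PRep

attribute [instance] PRep.acg PRep.mod

variable {k : Type} [Field k] {P : Type} [Preorder P]

/-- Homomorphisms of representations. -/
structure Hom (M N : PRep k P) where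
  app : ∀ p, M.X p →ₗ[k] N.X p
  comm : ∀ {p q : P} (h : p ≤ q) (x : M.X p), app q (M.map h x) = N.map h (app p x)

/-- Short exactness of `0 → M → N → L → 0`, tested degreewise. -/
structure SES {M N L : PRep k P} (f : Hom M N) (g : Hom N L) : Prop where
  inj : ∀ p, Function.Injective (f.app p)
  exact : ∀ p, Function.Exact (f.app p) (g.app p)
  surj : ∀ p, Function.Surjective (g.app p)

/-- Pullback of a representation along a monotone map. -/
def comap {Q : Type} [Preorder Q] (M : PRep k P) (φ : Q → P) (hφ : Monotone φ) : PRep k Q where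
  X q := M.X (φ q)
  map h := M.map (hφ h)
  map_refl _ x := M.map_refl _ x
  map_map _ _ x := M.map_map _ _ x

/-- The finite direct sum of the modules `k[{q | q ≤ r j}]`, `j : J`. -/
def cofree (k : Type) [Field k] {J : Type} (r : J → P) : PRep k P where
  X q := {j // q ≤ r j} → k
  map h := LinearMap.funLeft k k fun j => ⟨j.1, h.trans j.2⟩
  map_refl _ _ := rfl
  map_map _ _ _ := rfl

/-- `ResLT d M`: there is an exact sequence `0 → M → E⁰ → ⋯ → E^(d-1) → 0` whose terms are
finite direct sums of modules `k[{q | q ≤ p}]`. -/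
def ResLT : ℕ → PRep k P → Prop
  | 0, M => ∀ p, Subsingleton (M.X p)
  | d + 1, M => ∃ (J : Type) (_ : Finite J) (r : J → P) (M' : PRep k P)
      (f : Hom M (cofree k r)) (g : Hom (cofree k r) M'), SES f g ∧ ResLT d M'

lemma exists_desc {E Y W : PRep k P} (g : Hom E Y) (hg : ∀ p, Function.Surjective (g.app p))
    (h : Hom E W) (H : ∀ p x, g.app p x = 0 → h.app p x = 0) :
    ∃ u : Hom Y W, ∀ p x, u.app p (g.app p x) = h.app p x := by
  have key : ∀ p, ∃ u : Y.X p →ₗ[k] W.X p, ∀ x, u (g.app p x) = h.app p x := by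
    intro p
    obtain ⟨s, hs⟩ := (g.app p).exists_rightInverse_of_surjective (LinearMap.range_eq_top.2 (hg p))
    refine ⟨h.app p ∘ₗ s, fun x => ?_⟩
    have h1 : g.app p (s (g.app p x)) = g.app p x := LinearMap.congr_fun hs _
    have h2 := H p (s (g.app p x) - x) (by rw [map_sub, h1, sub_self])
    rw [map_sub, sub_eq_zero] at h2
    exact h2
  choose u hu using key
  refine ⟨⟨u, fun {p q} hpq x => ?_⟩, hu⟩
  obtain ⟨y, rfl⟩ := hg p x
  rw [← g.comm, hu, hu, h.comm]

lemma exists_coker {M E : PRep k P} (f : Hom M E) (hf : ∀ p, Function.Injective (f.app p)) :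
    ∃ (C : PRep k P) (g : Hom E C), SES f g := by
  refine ⟨{ X := fun p => E.X p ⧸ LinearMap.range (f.app p)
            map := fun {p q} h => Submodule.mapQ _ _ (E.map h) ?_
            map_refl := ?_
            map_map := ?_ }, ⟨fun p => Submodule.mkQ _, ?_⟩, hf, ?_, ?_⟩
  · rintro _ ⟨x, rfl⟩
    exact ⟨M.map h x, f.comm h x⟩
  · intro p x
    obtain ⟨x, rfl⟩ := Submodule.mkQ_surjective _ x
    simp [E.map_refl]
  · intro p q r h h' x
    obtain ⟨x, rfl⟩ := Submodule.mkQ_surjective _ x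
    simp [E.map_map]
  · intro p q h x
    simp
  · intro p
    rw [LinearMap.exact_iff]
    exact Submodule.ker_mkQ _
  · intro p
    exact Submodule.mkQ_surjective _

/-- Finite direct sums of the modules `k[{q | q ≤ p}]` are injective. -/
lemma exists_extend_cofree {M N : PRep k P} {J : Type} (r : J → P) (f : Hom M N)
    (hf : ∀ p, Function.Injective (f.app p)) (u : Hom M (cofree k r)) :
    ∃ v : Hom N (cofree k r), ∀ p x, v.app p (f.app p x) = u.app p x := by
  have key : ∀ j, ∃ w : N.X (r j) →ₗ[k] k,
      ∀ x, w (f.app _ x) = u.app (r j) x ⟨j, le_refl _⟩ := by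
    intro j
    obtain ⟨s, hs⟩ := (f.app (r j)).exists_leftInverse_of_injective (LinearMap.ker_eq_bot.2 (hf _))
    let w : M.X (r j) →ₗ[k] k :=
      (LinearMap.proj (R := k) (φ := fun _ : {j' // r j ≤ r j'} => k) ⟨j, le_refl _⟩) ∘ₗ
        u.app (r j)
    refine ⟨w ∘ₗ s, fun x => ?_⟩
    have h1 : s (f.app _ x) = x := LinearMap.congr_fun hs x
    change w (s (f.app _ x)) = w x
    rw [h1]
  choose w hw using key
  refine ⟨⟨fun p => LinearMap.pi fun j => w j.1 ∘ₗ N.map j.2, ?_⟩, ?_⟩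
  · intro p q h x
    funext j
    change w j.1 (N.map _ (N.map _ x)) = w j.1 (N.map _ x)
    rw [N.map_map]
  · intro p x
    funext j
    change w j.1 (N.map j.2 (f.app p x)) = _
    rw [← f.comm, hw, u.comm]
    rfl

lemma ResLT.succ {d : ℕ} {M : PRep k P} (h : ResLT d M) : ResLT (d + 1) M := by
  induction d generalizing M with
  | zero =>
    refine ⟨Empty, inferInstance, Empty.elim, M, ⟨fun _ => 0, ?_⟩, ⟨fun _ => 0, ?_⟩, ⟨?_, ?_, ?_⟩, h⟩
    · intros; simp
    · intros; simp
    · intro p x y _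
      exact (h p).elim x y
    · intro p x
      exact ⟨fun _ => ⟨0, funext fun j => j.1.elim⟩, fun _ => rfl⟩
    · intro p x
      exact ⟨0, (h p).elim _ _⟩
  | succ d ih =>
    obtain ⟨J, hJ, r, M', f, g, hs, h'⟩ := h
    exact ⟨J, hJ, r, M', f, g, hs, ih h'⟩

/-- The horseshoe lemma. -/
lemma ResLT.extension {d : ℕ} {Y Z X : PRep k P} {a : Hom Y Z} {b : Hom Z X} (hab : SES a b)
    (hY : ResLT d Y) (hX : ResLT d X) : ResLT d Z := by
  induction d generalizing Y Z X with
  | zero =>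
    intro p
    refine ⟨fun x y => ?_⟩
    have : b.app p (x - y) = 0 := (hX p).elim _ _
    obtain ⟨z, hz⟩ := (hab.exact p _).1 this
    rw [(hY p).elim z 0, map_zero] at hz
    exact (sub_eq_zero.1 hz.symm)
  | succ d ih =>
    obtain ⟨J, hJ, r, Y', f, g, hfg, hY'⟩ := hY
    obtain ⟨J₁, hJ₁, r₁, X', f₁, g₁, hfg₁, hX'⟩ := hX
    obtain ⟨v, hv⟩ := exists_extend_cofree r a hab.inj f
    let φ : Hom Z (cofree k (Sum.elim r r₁)) :=
      { app := fun p =>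
          { toFun := fun z j => match j with
              | ⟨Sum.inl j, hj⟩ => v.app p z ⟨j, hj⟩
              | ⟨Sum.inr j, hj⟩ => f₁.app p (b.app p z) ⟨j, hj⟩
            map_add' := by
              intro x y
              funext j
              rcases j with ⟨j | j, hj⟩
              · exact congrFun (map_add (v.app p) x y) ⟨j, hj⟩
              · exact congrFun (map_add (f₁.app p ∘ₗ b.app p) x y) ⟨j, hj⟩
            map_smul' := by
              intro c x
              funext j
              rcases j with ⟨j | j, hj⟩
              · exact congrFun (map_smul (v.app p) c x) ⟨j, hj⟩
              · exact congrFun (map_smul (f₁.app p ∘ₗ b.app p) c x) ⟨j, hj⟩ }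
        comm := by
          intro p q h x
          funext j
          rcases j with ⟨j | j, hj⟩
          · exact congrFun (v.comm h x) ⟨j, hj⟩
          · change f₁.app q (b.app q (Z.map h x)) ⟨j, hj⟩ = _
            rw [b.comm, f₁.comm]
            rfl }
    have hφl : ∀ p z j hj, φ.app p z ⟨Sum.inl j, hj⟩ = v.app p z ⟨j, hj⟩ := fun _ _ _ _ => rfl
    have hφr : ∀ p z j hj, φ.app p z ⟨Sum.inr j, hj⟩ = f₁.app p (b.app p z) ⟨j, hj⟩ :=
      fun _ _ _ _ => rfl
    have hφ : ∀ p, Function.Injective (φ.app p) := by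
      intro p
      rw [injective_iff_map_eq_zero]
      intro z hz
      have h1 : f₁.app p (b.app p z) = 0 := funext fun j => congrFun hz ⟨Sum.inr j.1, j.2⟩
      have h2 : b.app p z = 0 := hfg₁.inj p (by rw [h1, map_zero])
      obtain ⟨y, rfl⟩ := (hab.exact p _).1 h2
      have h3 : v.app p (a.app p y) = 0 := funext fun j => congrFun hz ⟨Sum.inl j.1, j.2⟩
      rw [hv] at h3
      have h4 : y = 0 := hfg.inj p (by rw [h3, map_zero])
      rw [h4, map_zero]
    obtain ⟨Z', ψ, hs⟩ := exists_coker φ hφ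
    let il : Hom (cofree k r) (cofree k (Sum.elim r r₁)) :=
      { app := fun p =>
          { toFun := fun z j => match j with
              | ⟨Sum.inl j, hj⟩ => z ⟨j, hj⟩
              | ⟨Sum.inr _, _⟩ => 0
            map_add' := by
              intro x y
              funext j
              rcases j with ⟨j | j, hj⟩
              · rfl
              · exact (add_zero (0 : k)).symm
            map_smul' := by
              intro c x
              funext j
              rcases j with ⟨j | j, hj⟩
              · rfl
              · exact (mul_zero c).symm }
        comm := by
          intro p q h x
          funext j
          rcases j with ⟨j | j, hj⟩ <;> rfl }
    let pr : Hom (cofree k (Sum.elim r r₁)) (cofree k r₁) :=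
      { app := fun p => LinearMap.funLeft k k fun j => ⟨Sum.inr j.1, j.2⟩
        comm := fun _ _ => rfl }
    obtain ⟨s, hsd⟩ := exists_desc g hfg.surj
      ⟨fun p => ψ.app p ∘ₗ il.app p, fun h x => by
        simp only [LinearMap.comp_apply, il.comm, ψ.comm]⟩ (by
        intro p x hx
        obtain ⟨y, rfl⟩ := (hfg.exact p _).1 hx
        refine (hs.exact p _).2 ⟨a.app p y, ?_⟩
        funext j
        rcases j with ⟨j | j, hj⟩
        · rw [hφl, hv]
          rfl
        · rw [hφr, (hab.exact p _).2 ⟨y, rfl⟩, map_zero]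
          rfl)
    obtain ⟨t, htd⟩ := exists_desc ψ hs.surj
      ⟨fun p => g₁.app p ∘ₗ pr.app p, fun h x => by
        simp only [LinearMap.comp_apply, pr.comm, g₁.comm]⟩ (by
        intro p x hx
        obtain ⟨z, rfl⟩ := (hs.exact p _).1 hx
        exact (hfg₁.exact p _).2 ⟨b.app p z, rfl⟩)
    refine ⟨J ⊕ J₁, inferInstance, Sum.elim r r₁, Z', φ, ψ, hs, ih (a := s) (b := t) ⟨?_, ?_, ?_⟩ hY' hX'⟩
    · intro p
      rw [injective_iff_map_eq_zero]
      intro y hy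
      obtain ⟨e, rfl⟩ := hfg.surj p y
      rw [hsd] at hy
      obtain ⟨z, hz⟩ := (hs.exact p _).1 hy
      have h1 : f₁.app p (b.app p z) = 0 := funext fun j => congrFun hz ⟨Sum.inr j.1, j.2⟩
      have h2 : b.app p z = 0 := hfg₁.inj p (by rw [h1, map_zero])
      obtain ⟨y, rfl⟩ := (hab.exact p _).1 h2
      have h3 : v.app p (a.app p y) = e := funext fun j => congrFun hz ⟨Sum.inl j.1, j.2⟩
      rw [hv] at h3
      exact (hfg.exact p _).2 ⟨y, h3⟩
    · intro p z
      constructor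
      · intro hz
        obtain ⟨e, rfl⟩ := hs.surj p z
        rw [htd] at hz
        obtain ⟨x, hx⟩ := (hfg₁.exact p _).1 hz
        obtain ⟨w, rfl⟩ := hab.surj p x
        refine ⟨g.app p fun j => e ⟨Sum.inl j.1, j.2⟩ - v.app p w j, ?_⟩
        refine (hsd _ _).trans ?_
        have h1 : il.app p (fun j => e ⟨Sum.inl j.1, j.2⟩ - v.app p w j) = e - φ.app p w := by
          funext j
          rcases j with ⟨j | j, hj⟩
          · rfl
          · have := congrFun hx ⟨j, hj⟩
            change 0 = e _ - f₁.app p (b.app p w) ⟨j, hj⟩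
            rw [this]
            exact (sub_self _).symm
        change ψ.app p (il.app p _) = _
        rw [h1, map_sub, (hs.exact p _).2 ⟨w, rfl⟩, sub_zero]
      · rintro ⟨y, rfl⟩
        obtain ⟨e, rfl⟩ := hfg.surj p y
        rw [hsd]
        change t.app p (ψ.app p _) = 0
        rw [htd]
        exact map_zero (g₁.app p)
    · intro p x
      obtain ⟨e, rfl⟩ := hfg₁.surj p x
      refine ⟨ψ.app p fun j => match j with
        | ⟨Sum.inl _, _⟩ => 0
        | ⟨Sum.inr j, hj⟩ => e ⟨j, hj⟩, ?_⟩
      exact htd _ _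

lemma ResLT.of_ses {d : ℕ} {N A B : PRep k P} {a : Hom N A} {b : Hom A B} (hab : SES a b)
    (hA : ResLT (d + 1) A) (hB : ResLT (d + 1) B) : ResLT (d + 2) N := by
  obtain ⟨J, hJ, r, A', f, g, hfg, hA'⟩ := hA
  let φ : Hom N (cofree k r) := ⟨fun p => f.app p ∘ₗ a.app p, fun h x => by
    simp only [LinearMap.comp_apply, a.comm, f.comm]⟩
  obtain ⟨N', ψ, hs⟩ := exists_coker φ fun p => (hfg.inj p).comp (hab.inj p)
  obtain ⟨s, hsd⟩ := exists_desc b hab.surj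
    ⟨fun p => ψ.app p ∘ₗ f.app p, fun h x => by
      simp only [LinearMap.comp_apply, f.comm, ψ.comm]⟩ (by
      intro p x hx
      obtain ⟨y, rfl⟩ := (hab.exact p _).1 hx
      exact (hs.exact p _).2 ⟨y, rfl⟩)
  obtain ⟨t, htd⟩ := exists_desc ψ hs.surj g (by
    intro p x hx
    obtain ⟨y, rfl⟩ := (hs.exact p _).1 hx
    exact (hfg.exact p _).2 ⟨_, rfl⟩)
  refine ⟨J, hJ, r, N', φ, ψ, hs, ResLT.extension (a := s) (b := t) ⟨?_, ?_, ?_⟩ hB hA'.succ⟩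
  · intro p
    rw [injective_iff_map_eq_zero]
    intro y hy
    obtain ⟨e, rfl⟩ := hab.surj p y
    rw [hsd] at hy
    obtain ⟨z, hz⟩ := (hs.exact p _).1 hy
    exact (hab.exact p _).2 ⟨z, hfg.inj p hz⟩
  · intro p z
    constructor
    · intro hz
      obtain ⟨e, rfl⟩ := hs.surj p z
      rw [htd] at hz
      obtain ⟨x, rfl⟩ := (hfg.exact p _).1 hz
      exact ⟨b.app p x, hsd p x⟩
    · rintro ⟨y, rfl⟩
      obtain ⟨e, rfl⟩ := hab.surj p y
      rw [hsd]
      change t.app p (ψ.app p _) = 0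
      rw [htd]
      exact (hfg.exact p _).2 ⟨_, rfl⟩
  · intro p x
    obtain ⟨e, rfl⟩ := hfg.surj p x
    exact ⟨ψ.app p e, htd p e⟩

/-- For a family `L t` of representations of `P`, the representation of `Q` which is
the direct sum of the pullbacks of `L t` along `π`, each cut off above `σ q ≤ r t`. -/
def coindFamily {Q C T : Type} [Preorder Q] [Preorder C] (π : Q → P) (hπ : Monotone π)
    (σ : Q → C) (hσ : Monotone σ) (r : T → C) (L : T → PRep k P) : PRep k Q where
  X q := ∀ t : {t // σ q ≤ r t}, (L t.1).X (π q)
  map h :=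
    { toFun := fun x t => (L t.1).map (hπ h) (x ⟨t.1, (hσ h).trans t.2⟩)
      map_add' := fun _ _ => funext fun _ => map_add _ _ _
      map_smul' := fun _ _ => funext fun _ => map_smul _ _ _ }
  map_refl _ x := funext fun t => (L t.1).map_refl _ (x t)
  map_map h h' x := funext fun t =>
    (L t.1).map_map (hπ h) (hπ h') (x ⟨t.1, (hσ (h.trans h')).trans t.2⟩)

lemma ResLT.coindFamily {Q C T : Type} [Preorder Q] [Preorder C] [Finite T] (π : Q → P)
    (hπ : Monotone π) (σ : Q → C) (hσ : Monotone σ) (r : T → C) (mk : P → C → Q)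
    (hmk : ∀ q p c, q ≤ mk p c ↔ π q ≤ p ∧ σ q ≤ c) {d : ℕ} (L : T → PRep k P)
    (hL : ∀ t, ResLT d (L t)) : ResLT d (coindFamily π hπ σ hσ r L) := by
  induction d generalizing L with
  | zero => exact fun q => ⟨fun x y => funext fun t => (hL t.1 _).elim _ _⟩
  | succ d ih =>
    choose J hJ rJ L' f g hs hL' using hL
    refine ⟨Σ t, J t, inferInstance, fun x => mk (rJ x.1 x.2) (r x.1),
      PRep.coindFamily π hπ σ hσ r L',
      ⟨fun q =>
        { toFun := fun y x => (f x.1.1).app (π q) (y ⟨x.1.1, ((hmk _ _ _).1 x.2).2⟩)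
            ⟨x.1.2, ((hmk _ _ _).1 x.2).1⟩
          map_add' := fun _ _ => funext fun x => congrFun (map_add ((f x.1.1).app (π q)) _ _) _
          map_smul' := fun _ _ => funext fun x =>
            congrFun (map_smul ((f x.1.1).app (π q)) _ _) _ }, ?_⟩,
      ⟨fun q =>
        { toFun := fun z t => (g t.1).app (π q) fun j =>
            z ⟨⟨t.1, j.1⟩, (hmk _ _ _).2 ⟨j.2, t.2⟩⟩
          map_add' := fun _ _ => funext fun t => map_add ((g t.1).app (π q)) _ _
          map_smul' := fun _ _ => funext fun t => map_smul ((g t.1).app (π q)) _ _ }, ?_⟩,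
      ⟨?_, ?_, ?_⟩, ih L' hL'⟩
    · intro p q h x
      funext j
      exact congrFun ((f j.1.1).comm (hπ h) _) _
    · intro p q h x
      funext t
      exact (g t.1).comm (hπ h) fun j =>
        x ⟨⟨t.1, j.1⟩, (hmk _ _ _).2 ⟨j.2, (hσ h).trans t.2⟩⟩
    · intro q x y hxy
      funext t
      refine (hs t.1).inj _ (funext fun j => ?_)
      exact congrFun hxy ⟨⟨t.1, j.1⟩, (hmk _ _ _).2 ⟨j.2, t.2⟩⟩
    · intro q z
      constructor
      · intro hz
        have h1 : ∀ t : {t // σ q ≤ r t}, ∃ x, (f t.1).app (π q) x =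
            fun j => z ⟨⟨t.1, j.1⟩, (hmk _ _ _).2 ⟨j.2, t.2⟩⟩ :=
          fun t => ((hs t.1).exact _ _).1 (congrFun hz t)
        choose x hx using h1
        exact ⟨x, funext fun j => congrFun
          (hx ⟨j.1.1, ((hmk _ _ _).1 j.2).2⟩) ⟨j.1.2, ((hmk _ _ _).1 j.2).1⟩⟩
      · rintro ⟨x, rfl⟩
        funext t
        exact ((hs t.1).exact _ _).2 ⟨x t, rfl⟩
    · intro q y
      choose z hz using fun t : {t // σ q ≤ r t} => (hs t.1).surj (π q) (y t)
      exact ⟨fun j => z ⟨j.1.1, ((hmk _ _ _).1 j.2).2⟩ ⟨j.1.2, ((hmk _ _ _).1 j.2).1⟩,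
        funext fun t => hz t⟩

lemma cons_monotone {n m : ℕ} (t : Fin (m + 1)) :
    Monotone fun p : Fin n → Fin (m + 1) => (Fin.cons t p : Fin (n + 1) → Fin (m + 1)) :=
  fun _ _ h => Fin.cons_le_cons.2 ⟨le_refl _, h⟩

lemma resLT_of_finiteDimensional (m : ℕ) : ∀ (n : ℕ) (M : PRep k (Fin n → Fin (m + 1))),
    (∀ p, FiniteDimensional k (M.X p)) → ResLT (n + 1) M := by
  intro n
  induction n with
  | zero =>
    intro M hM
    have hp : ∀ p q : Fin 0 → Fin (m + 1), p ≤ q := fun p q i => i.elim0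
    let p₀ : Fin 0 → Fin (m + 1) := fun i => i.elim0
    have := hM p₀
    let b := Module.finBasis k (M.X p₀)
    have hinj : ∀ p, Function.Injective (M.map (hp p p₀)) := fun p x y h => by
      rw [← M.map_refl p x, ← M.map_map (hp p p₀) (hp p₀ p), h, M.map_map, M.map_refl]
    have hb : ∀ p, Function.Bijective
        (b.equivFun.toLinearMap ∘ₗ M.map (hp p p₀)) := fun p => by
      refine ⟨b.equivFun.injective.comp (hinj p), b.equivFun.surjective.comp fun x => ?_⟩
      exact ⟨M.map (hp p₀ p) x, by rw [M.map_map, M.map_refl]⟩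
    refine ⟨Fin (Module.finrank k (M.X p₀)), inferInstance, fun _ => p₀,
      ⟨fun _ => PUnit, fun _ => 0, fun _ _ => rfl, fun _ _ _ => rfl⟩,
      ⟨fun p => LinearMap.funLeft k k (fun j => j.1) ∘ₗ
        (b.equivFun.toLinearMap ∘ₗ M.map (hp p p₀)), ?_⟩, ⟨fun p => 0, fun _ _ => rfl⟩,
        ⟨?_, ?_, ?_⟩, fun _ => inferInstanceAs (Subsingleton PUnit)⟩
    · intro p q h x
      funext j
      change b.equivFun (M.map _ (M.map _ x)) j.1 = b.equivFun (M.map _ x) j.1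
      rw [M.map_map]
    · intro p x y hxy
      exact (hb p).1 (funext fun j => congrFun hxy ⟨j, hp _ _⟩)
    · intro p z
      refine ⟨fun _ => ?_, fun _ => rfl⟩
      obtain ⟨x, hx⟩ := (hb p).2 fun j => z ⟨j, hp _ _⟩
      exact ⟨x, funext fun j => congrFun hx j.1⟩
    · intro p x
      exact ⟨0, rfl⟩
  | succ n ih =>
    intro M hM
    have hπ : Monotone fun q : Fin (n + 1) → Fin (m + 1) => Fin.tail q := fun _ _ h i => h i.succ
    have hσ : Monotone fun q : Fin (n + 1) → Fin (m + 1) => q 0 := fun _ _ h => h 0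
    have hmk : ∀ (q : Fin (n + 1) → Fin (m + 1)) (p : Fin n → Fin (m + 1)) (c : Fin (m + 1)),
        q ≤ Fin.cons c p ↔ Fin.tail q ≤ p ∧ q 0 ≤ c := fun q p c => Fin.le_cons.trans and_comm
    let L : Fin (m + 1) → PRep k (Fin n → Fin (m + 1)) := fun t =>
      M.comap (fun p => Fin.cons t p) (cons_monotone t)
    have hL : ∀ t, ResLT (n + 1) (L t) := fun t => ih _ fun p => hM _
    have hc : ∀ {t s : Fin (m + 1)} (p : Fin n → Fin (m + 1)), t ≤ s →
        (Fin.cons t p : Fin (n + 1) → Fin (m + 1)) ≤ Fin.cons s p :=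
      fun p h => Fin.cons_le_cons.2 ⟨h, le_refl _⟩
    have hback : ∀ q : Fin (n + 1) → Fin (m + 1), Fin.cons (q 0) (Fin.tail q) ≤ q :=
      fun q => (Fin.cons_self_tail q).le
    have hto : ∀ (q : Fin (n + 1) → Fin (m + 1)) {t : Fin (m + 1)}, q 0 ≤ t →
      q ≤ Fin.cons t (Fin.tail q) := fun q t h => (hmk _ _ _).2 ⟨le_refl _, h⟩
    let tr : ∀ (t : Fin m) p, (L t.castSucc).X p →ₗ[k] (L t.succ).X p := fun t p =>
      M.map (hc p (Fin.castSucc_lt_succ).le)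
    let i : ∀ (q : Fin (n + 1) → Fin (m + 1)) (t : Fin (m + 1)), q 0 ≤ t →
      (M.X q →ₗ[k] (L t).X (Fin.tail q)) := fun q t h => M.map (hto q h)
    let o : ∀ q : Fin (n + 1) → Fin (m + 1), (L (q 0)).X (Fin.tail q) →ₗ[k] M.X q :=
      fun q => M.map (hback q)
    have htr : ∀ t p p' (h : p ≤ p') x,
        tr t p' ((L t.castSucc).map h x) = (L t.succ).map h (tr t p x) := fun t p p' h x =>
      (M.map_map _ _ x).trans (M.map_map _ _ x).symm
    have hi : ∀ q q' (h : q ≤ q') t ht ht' x,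
        i q' t ht' (M.map h x) = (L t).map (hπ h) (i q t ht x) := fun q q' h t ht ht' x =>
      (M.map_map _ _ x).trans (M.map_map _ _ x).symm
    have hio : ∀ q x, i q (q 0) (le_refl _) (o q x) = x := fun q x =>
      (M.map_map _ _ x).trans (M.map_refl _ _)
    have hoi : ∀ q x, o q (i q (q 0) (le_refl _) x) = x := fun q x =>
      (M.map_map _ _ x).trans (M.map_refl _ _)
    have htri : ∀ q (t : Fin m) ht ht' x,
        tr t (Fin.tail q) (i q t.castSucc ht x) = i q t.succ ht' x := fun q t ht ht' x =>
      M.map_map _ _ x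
    clear_value tr i o
    let A := PRep.coindFamily (fun q : Fin (n + 1) → Fin (m + 1) => Fin.tail q) hπ
      (fun q => q 0) hσ id L
    let B := PRep.coindFamily (fun q : Fin (n + 1) → Fin (m + 1) => Fin.tail q) hπ
      (fun q => q 0) hσ Fin.castSucc fun t : Fin m => L t.succ
    let a : Hom M A :=
      { app := fun q =>
          { toFun := fun x t => i q t.1 t.2 x
            map_add' := fun _ _ => funext fun _ => map_add _ _ _
            map_smul' := fun _ _ => funext fun _ => map_smul _ _ _ }
        comm := fun h x => funext fun t => hi _ _ h _ _ _ x }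
    let b : Hom A B :=
      { app := fun q =>
          { toFun := fun y t => y ⟨t.1.succ, t.2.trans (Fin.castSucc_lt_succ).le⟩ -
              tr t.1 (Fin.tail q) (y ⟨t.1.castSucc, t.2⟩)
            map_add' := fun x y => funext fun t => by
              refine (congrArg _ (map_add (tr t.1 (Fin.tail q)) (x ⟨t.1.castSucc, t.2⟩)
                (y ⟨t.1.castSucc, t.2⟩))).trans ?_
              exact add_sub_add_comm _ _ _ _
            map_smul' := fun c x => funext fun t => by
              refine (congrArg _ (map_smul (tr t.1 (Fin.tail q)) c
                (x ⟨t.1.castSucc, t.2⟩))).trans ?_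
              exact (smul_sub c (x ⟨t.1.succ, t.2.trans (Fin.castSucc_lt_succ).le⟩)
                (tr t.1 (Fin.tail q) (x ⟨t.1.castSucc, t.2⟩))).symm }
        comm := fun {p q} h x => funext fun t => by
          refine (congrArg _ (htr t.1 _ _ (hπ h)
            (x ⟨t.1.castSucc, (hσ h).trans t.2⟩))).trans ?_
          exact (map_sub ((L t.1.succ).map (hπ h)) _ _).symm }
    have hb : ∀ q (y : A.X q) (t : Fin m) (ht : q 0 ≤ t.castSucc),
        b.app q y ⟨t, ht⟩ = y ⟨t.succ, ht.trans (Fin.castSucc_lt_succ).le⟩ -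
          tr t (Fin.tail q) (y ⟨t.castSucc, ht⟩) :=
      fun _ _ _ _ => rfl
    refine ResLT.of_ses (a := a) (b := b) ⟨?_, ?_, ?_⟩
      (ResLT.coindFamily _ hπ _ hσ _ (fun p c => Fin.cons c p) hmk _ hL)
      (ResLT.coindFamily _ hπ _ hσ _ (fun p c => Fin.cons c p) hmk _ fun t => hL _)
    · intro q x y hxy
      have h1 : i q (q 0) (le_refl _) x = i q (q 0) (le_refl _) y := congrFun hxy ⟨q 0, le_refl _⟩
      rw [← hoi q x, h1, hoi]
    · intro q y
      constructor
      · intro hy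
        refine ⟨o q (y ⟨q 0, le_refl _⟩), ?_⟩
        have hstart : ∀ t (ht : q 0 ≤ t), t = q 0 →
            i q t ht (o q (y ⟨q 0, le_refl _⟩)) = y ⟨t, ht⟩ := by
          rintro s hs rfl
          exact hio _ _
        have key : ∀ t (ht : q 0 ≤ t), i q t ht (o q (y ⟨q 0, le_refl _⟩)) = y ⟨t, ht⟩ := by
          intro t
          induction t using Fin.induction with
          | zero =>
            intro ht
            exact hstart 0 ht (le_antisymm ht (Fin.zero_le _)).symm
          | succ t iht =>
            intro ht
            rcases ht.lt_or_eq with h | h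
            · have h' : q 0 ≤ t.castSucc := Fin.le_castSucc_iff.2 h
              have h2 := congrFun hy ⟨t, h'⟩
              rw [hb, ← iht h', htri q t h' ht] at h2
              exact (sub_eq_zero.1 h2).symm
            · exact hstart _ ht h.symm
        exact funext fun t => key t.1 t.2
      · rintro ⟨x, rfl⟩
        funext ⟨t, ht⟩
        rw [hb]
        change i q _ _ x - tr _ _ (i q _ _ x) = 0
        rw [htri q t ht (ht.trans (Fin.castSucc_lt_succ).le), sub_self]
    · intro q z
      classical
      let y : ∀ t : Fin (m + 1), (L t).X (Fin.tail q) := fun t =>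
        Fin.induction (motive := fun t => (L t).X (Fin.tail q)) 0
          (fun t y => tr t (Fin.tail q) y + if h : q 0 ≤ t.castSucc then z ⟨t, h⟩ else 0) t
      have hy : ∀ t : Fin m, y t.succ = tr t (Fin.tail q) (y t.castSucc) +
          if h : q 0 ≤ t.castSucc then z ⟨t, h⟩ else 0 :=
        fun t => Fin.induction_succ _ _ _
      refine ⟨fun t => y t.1, funext fun ⟨t, ht⟩ => ?_⟩
      refine (hb q (fun t => y t.1) t ht).trans ?_
      change y t.succ - tr t _ (y t.castSucc) = _
      rw [hy, dif_pos ht]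
      exact add_sub_cancel_left _ _


lemma bijective_map_of_path {n : ℕ} (N : PRep k (Fin n → ℤ)) (c : ℤ)
    (hN : ∀ (i : Fin n) (b : Fin n → ℤ), c < |b i| → ∀ h : b ≤ b + Pi.single i 1,
      Function.Bijective (N.map h)) :
    ∀ (s : ℕ) (q q' : Fin n → ℤ) (h : q ≤ q'), ∑ i, (q' i - q i).toNat = s →
      (∀ i, q i ≠ q' i → q' i ≤ -c ∨ c < q i) → Function.Bijective (N.map h) := by
  intro s
  induction s with
  | zero =>
    intro q q' h hs _
    have hqq : q = q' := by
      funext i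
      have h1 : (q' i - q i).toNat = 0 := (Finset.sum_eq_zero_iff.1 hs) i (Finset.mem_univ i)
      have h2 : q i ≤ q' i := h i
      omega
    subst hqq
    rw [show N.map h = LinearMap.id from LinearMap.ext (N.map_refl q)]
    exact Function.bijective_id
  | succ s ih =>
    intro q q' h hs hq
    obtain ⟨i, -, hi⟩ : ∃ i ∈ Finset.univ, 0 < (q' i - q i).toNat := by
      by_contra! hcon
      have : ∑ i, (q' i - q i).toNat = 0 :=
        Finset.sum_eq_zero fun i hi => Nat.le_zero.1 (hcon i hi)
      omega
    have h1 : q ≤ q + Pi.single i 1 :=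
      le_add_of_nonneg_right (Pi.single_nonneg.mpr zero_le_one)
    have h2 : q + Pi.single i 1 ≤ q' := by
      intro j
      by_cases hj : j = i
      · subst hj
        simp only [Pi.add_apply, Pi.single_eq_same]
        omega
      · simpa [hj] using h j
    have hsum : ∑ j, (q' j - (q + Pi.single i 1 : Fin n → ℤ) j).toNat = s := by
      have : ∑ j, (q' j - q j).toNat =
          ∑ j, ((q' j - (q + Pi.single i 1 : Fin n → ℤ) j).toNat + (Pi.single i 1 : Fin n → ℕ) j) := by
        refine Finset.sum_congr rfl fun j _ => ?_
        by_cases hj : j = i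
        · subst hj
          simp only [Pi.add_apply, Pi.single_eq_same]
          omega
        · simp [hj]
      rw [Finset.sum_add_distrib, Finset.sum_pi_single', if_pos (Finset.mem_univ i)] at this
      omega
    have hb1 := hN i q (by
      rcases hq i (by omega) with h3 | h3
      · exact lt_abs.2 (Or.inr (by omega))
      · exact lt_abs.2 (Or.inl h3)) h1
    have hb2 := ih _ _ h2 hsum (by
      intro j hj
      by_cases hji : j = i
      · subst hji
        have h3 := hq j (by omega)
        simp only [Pi.add_apply, Pi.single_eq_same]
        omega
      · simpa [hji] using hq j (by simpa [hji] using hj))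
    have hcomp := hb2.comp hb1
    rwa [← LinearMap.coe_comp,
      show N.map h2 ∘ₗ N.map h1 = N.map h from LinearMap.ext fun x => N.map_map _ _ x] at hcomp

lemma exists_hom_of_cospan {N N₁ N₂ : PRep k P} (a : Hom N N₂) (b : Hom N₁ N₂)
    (ha : ∀ p, Function.Bijective (a.app p)) (hb : ∀ p, Function.Bijective (b.app p)) :
    ∃ e : Hom N N₁, ∀ p, Function.Bijective (e.app p) := by
  let β := fun p => LinearEquiv.ofBijective (b.app p) (hb p)
  refine ⟨⟨fun p => (β p).symm.toLinearMap ∘ₗ a.app p, fun {p q} h x => ?_⟩,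
    fun p => (β p).symm.bijective.comp (ha p)⟩
  refine (hb q).1 ?_
  rw [b.comm]
  have h1 : ∀ p y, b.app p ((β p).symm y) = y := fun p y => (β p).apply_symm_apply y
  simp only [LinearMap.comp_apply, LinearEquiv.coe_coe, h1, a.comm]

/-- A variant of `HasFiniteDownsetResolution` in which the terms of index `≥ ℓ` vanish. -/
def HasDownsetResolutionLT {n : ℕ} (N : PRep k (Fin n → ℤ)) (ℓ : ℕ) : Prop :=
  ∃ (m : ℕ → ℕ) (b : ∀ i : ℕ, Fin (m i) → (Fin n → ℤ))
    (τ : ∀ i : ℕ, Fin (m i) → Set (Fin n)),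
    (∀ i : ℕ, ℓ ≤ i → m i = 0) ∧
    ∃ (ε : ∀ q : Fin n → ℤ, N.X q →ₗ[k] DSum k (m 0) (b 0) (τ 0) q)
      (δ : ∀ (i : ℕ) (q : Fin n → ℤ),
        DSum k (m i) (b i) (τ i) q →ₗ[k] DSum k (m (i + 1)) (b (i + 1)) (τ (i + 1)) q),
      (∀ (q q' : Fin n → ℤ) (h : q ≤ q'),
        DSumMap k (m 0) (b 0) (τ 0) h ∘ₗ ε q = ε q' ∘ₗ N.map h) ∧
      (∀ (i : ℕ) (q q' : Fin n → ℤ) (h : q ≤ q'),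
        DSumMap k (m (i + 1)) (b (i + 1)) (τ (i + 1)) h ∘ₗ δ i q
          = δ i q' ∘ₗ DSumMap k (m i) (b i) (τ i) h) ∧
      (∀ q : Fin n → ℤ, Function.Injective (ε q)) ∧
      (∀ q : Fin n → ℤ, LinearMap.range (ε q) = LinearMap.ker (δ 0 q)) ∧
      (∀ (i : ℕ) (q : Fin n → ℤ),
        LinearMap.range (δ i q) = LinearMap.ker (δ (i + 1) q))

lemma HasDownsetResolutionLT.of_subsingleton {n : ℕ} (N : PRep k (Fin n → ℤ))
    (hN : ∀ q, Subsingleton (N.X q)) : HasDownsetResolutionLT N 0 := by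
  have h0 : ∀ (b : Fin 0 → Fin n → ℤ) (τ : Fin 0 → Set (Fin n)) (q : Fin n → ℤ),
      Subsingleton (DSum k 0 b τ q) := fun _ _ _ => ⟨fun x y => funext fun j => j.elim0⟩
  refine ⟨fun _ => 0, fun _ j => j.elim0, fun _ j => j.elim0, fun _ _ => rfl,
    fun _ => 0, fun _ _ => 0, ?_, ?_, ?_, ?_, ?_⟩
  · intro q q' h
    simp
  · intro i q q' h
    simp
  · intro q x y _
    exact (hN q).elim _ _
  · intro q
    exact Subsingleton.elim _ _
  · intro i q
    exact Subsingleton.elim _ _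

lemma HasDownsetResolutionLT.cons {n ℓ : ℕ} {N N' : PRep k (Fin n → ℤ)} {m₀ : ℕ}
    {b₀ : Fin m₀ → Fin n → ℤ} {τ₀ : Fin m₀ → Set (Fin n)}
    (a : ∀ q, N.X q →ₗ[k] DSum k m₀ b₀ τ₀ q) (g : ∀ q, DSum k m₀ b₀ τ₀ q →ₗ[k] N'.X q)
    (ha : ∀ (q q' : Fin n → ℤ) (h : q ≤ q'),
      DSumMap k m₀ b₀ τ₀ h ∘ₗ a q = a q' ∘ₗ N.map h)
    (hg : ∀ (q q' : Fin n → ℤ) (h : q ≤ q'),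
      N'.map h ∘ₗ g q = g q' ∘ₗ DSumMap k m₀ b₀ τ₀ h)
    (inj : ∀ q, Function.Injective (a q))
    (exact : ∀ q, Function.Exact (a q) (g q))
    (surj : ∀ q, Function.Surjective (g q))
    (H : HasDownsetResolutionLT N' ℓ) : HasDownsetResolutionLT N (ℓ + 1) := by
  obtain ⟨m, b, τ, hm, ε, δ, hε, hδ, hinj, hex, hex'⟩ := H
  refine ⟨fun i => Nat.casesOn i m₀ m,
    fun i => Nat.casesOn (motive := fun i => Fin (Nat.casesOn i m₀ m) → Fin n → ℤ) i b₀ b,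
    fun i => Nat.casesOn (motive := fun i => Fin (Nat.casesOn i m₀ m) → Set (Fin n)) i τ₀ τ,
    ?_, a, fun i => match i with
      | 0 => fun q => ε q ∘ₗ g q
      | i + 1 => δ i, ha, ?_, inj, ?_, ?_⟩
  · intro i hi
    cases i with
    | zero => omega
    | succ i => exact hm i (by omega)
  · intro i q q' h
    cases i with
    | zero =>
      change DSumMap k (m 0) (b 0) (τ 0) h ∘ₗ (ε q ∘ₗ g q) =
        (ε q' ∘ₗ g q') ∘ₗ DSumMap k m₀ b₀ τ₀ h
      rw [← LinearMap.comp_assoc, hε, LinearMap.comp_assoc, hg, LinearMap.comp_assoc]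
    | succ i => exact hδ i q q' h
  · intro q
    change LinearMap.range (a q) = LinearMap.ker (ε q ∘ₗ g q)
    rw [LinearMap.ker_comp, LinearMap.ker_eq_bot.2 (hinj q), Submodule.comap_bot]
    exact (LinearMap.exact_iff.1 (exact q)).symm
  · intro i q
    cases i with
    | zero =>
      change LinearMap.range (ε q ∘ₗ g q) = LinearMap.ker (δ 0 q)
      rw [LinearMap.range_comp_of_range_eq_top _ (LinearMap.range_eq_top.2 (surj q)), hex]
    | succ i => exact hex' i q

end PRep

lemma mem_downInj {n : ℕ} {b : Fin n → ℤ} {τ : Set (Fin n)} {q : Fin n → ℤ} :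
    q ∈ downInj b τ ↔ ∀ i, i ∉ τ → q i ≤ b i := by
  constructor
  · rintro ⟨_, ⟨_, rfl, z, hz, rfl⟩, w, hw, rfl⟩ i hi
    have h1 : z i = 0 := hz i hi
    have h2 : 0 ≤ w i := hw i
    simp only [Pi.sub_apply, Pi.add_apply]
    omega
  · intro h
    classical
    refine ⟨b + fun i => if i ∈ τ then |q i - b i| else 0, ⟨b, rfl, _, ?_, rfl⟩,
      (b + fun i => if i ∈ τ then |q i - b i| else 0) - q, ?_, sub_sub_cancel _ _⟩
    · intro i hi
      exact if_neg hi
    · intro i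
      by_cases hi : i ∈ τ
      · have := le_abs_self (q i - b i)
        simp only [Pi.zero_apply, Pi.sub_apply, Pi.add_apply, if_pos hi]
        omega
      · have := h i hi
        simp only [Pi.zero_apply, Pi.sub_apply, Pi.add_apply, if_neg hi]
        omega

section IndicatorModules

variable {k : Type} [Field k] {Q : Type} {S : Set Q} {q q' : Q}

lemma mem_cmpt (hq : q ∈ S) (c : k) : c ∈ cmpt k S q := by
  simp [cmpt, hq]

lemma cmpt_coe_eq_zero (hq : q ∉ S) (x : cmpt k S q) : (x : k) = 0 := by
  have := x.2
  simpa [cmpt, hq] using this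

variable [PartialOrder Q]

lemma stMap_coe_of_mem (h : q ≤ q') (hq : q ∈ S) (hq' : q' ∈ S) (x : cmpt k S q) :
    (stMap k S h x : k) = x := by
  simp [stMap, hq, hq']

lemma stMap_bijective (h : q ≤ q') (hS : q ∈ S ↔ q' ∈ S) :
    Function.Bijective (stMap k S h) := by
  by_cases hq : q ∈ S
  · have hq' := hS.1 hq
    refine ⟨fun x y hxy => Subtype.ext ?_, fun y => ⟨⟨y, mem_cmpt hq _⟩, Subtype.ext ?_⟩⟩
    · rw [← stMap_coe_of_mem h hq hq' x, hxy, stMap_coe_of_mem h hq hq']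
    · rw [stMap_coe_of_mem h hq hq']
  · have hq' := fun h => hq (hS.2 h)
    refine ⟨fun x y _ => Subtype.ext ?_, fun y => ⟨0, Subtype.ext ?_⟩⟩
    · rw [cmpt_coe_eq_zero hq, cmpt_coe_eq_zero hq]
    · rw [cmpt_coe_eq_zero hq', cmpt_coe_eq_zero hq']

end IndicatorModules

namespace PRep

variable {k : Type} [Field k] {P : Type} [Preorder P]

lemma exists_equiv_DSum {n : ℕ} (κ : (Fin n → ℤ) → P) (hκ : Monotone κ) {J : Type} (r : J → P)
    {m : ℕ} (e : Fin m ≃ J) (b : Fin m → Fin n → ℤ) (τ : Fin m → Set (Fin n))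
    (hbτ : ∀ j q, q ∈ downInj (b j) (τ j) ↔ κ q ≤ r (e j)) :
    ∃ φ : ∀ q, (cofree k r).X (κ q) ≃ₗ[k] DSum k m b τ q,
      ∀ (q q' : Fin n → ℤ) (h : q ≤ q') (x : (cofree k r).X (κ q)),
        DSumMap k m b τ h (φ q x) = φ q' ((cofree k r).map (hκ h) x) := by
  classical
  let φ : ∀ q, (cofree k r).X (κ q) ≃ₗ[k] DSum k m b τ q := fun q =>
    { toFun := fun x j => if h : κ q ≤ r (e j) then ⟨x ⟨e j, h⟩, mem_cmpt ((hbτ j q).2 h) _⟩ else 0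
      invFun := fun y j => (y (e.symm j.1)).1
      map_add' := fun x y => by
        funext j
        by_cases h : κ q ≤ r (e j)
        · simp only [Pi.add_apply, dif_pos h]
          rfl
        · simp only [Pi.add_apply, dif_neg h, add_zero]
      map_smul' := fun c x => by
        funext j
        by_cases h : κ q ≤ r (e j)
        · simp only [Pi.smul_apply, dif_pos h]
          rfl
        · simp only [Pi.smul_apply, dif_neg h, smul_zero]
      left_inv := fun x => by
        funext ⟨j, hj⟩
        obtain ⟨j, rfl⟩ := e.surjective j
        simp only [Equiv.symm_apply_apply, dif_pos hj]
      right_inv := fun y => by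
        funext j
        by_cases h : κ q ≤ r (e j)
        · have this : ∀ j', j' = j → (y j' : k) = (y j : k) := by
            rintro _ rfl
            rfl
          simp only [dif_pos h]
          exact Subtype.ext (this _ (e.symm_apply_apply j))
        · simp only [dif_neg h]
          exact Subtype.ext (cmpt_coe_eq_zero (fun h' => h ((hbτ j q).1 h')) _).symm }
  have hφ : ∀ q x j (h : κ q ≤ r (e j)), (φ q x j : k) = x ⟨e j, h⟩ := fun q x j h => by
    change ((if h : κ q ≤ r (e j) then ⟨x ⟨e j, h⟩, mem_cmpt ((hbτ j q).2 h) _⟩ else 0 :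
      cmpt k (downInj (b j) (τ j)) q) : k) = _
    rw [dif_pos h]
  refine ⟨φ, fun q q' h x => funext fun j => Subtype.ext ?_⟩
  by_cases hj : κ q' ≤ r (e j)
  · have hj' := (hκ h).trans hj
    rw [hφ q' _ j hj]
    refine (stMap_coe_of_mem h ((hbτ j q).2 hj') ((hbτ j q').2 hj) _).trans ?_
    exact hφ q x j hj'
  · have hj' : q' ∉ downInj (b j) (τ j) := fun h => hj ((hbτ j q').1 h)
    rw [cmpt_coe_eq_zero hj', cmpt_coe_eq_zero hj']

lemma ResLT.hasDownsetResolutionLT {n : ℕ} (κ : (Fin n → ℤ) → P) (hκ : Monotone κ)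
    (b : P → Fin n → ℤ) (τ : P → Set (Fin n))
    (hbτ : ∀ p q, q ∈ downInj (b p) (τ p) ↔ κ q ≤ p) {d : ℕ} {M : PRep k P} (hM : ResLT d M)
    (N : PRep k (Fin n → ℤ)) (e : Hom N (M.comap κ hκ))
    (he : ∀ q, Function.Bijective (e.app q)) : HasDownsetResolutionLT N d := by
  induction d generalizing M N with
  | zero =>
    exact .of_subsingleton N fun q => ⟨fun x y => (he q).1 ((hM (κ q)).elim _ _)⟩
  | succ d ih =>
    obtain ⟨J, hJ, r, M', f, g, hs, hM'⟩ := hM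
    have E := (Finite.equivFin J).symm
    obtain ⟨φ, hφ⟩ := exists_equiv_DSum (k := k) κ hκ r E (fun j => b (r (E j)))
      (fun j => τ (r (E j))) fun j q => hbτ _ _
    have hφ' : ∀ q q' (h : q ≤ q') y, (cofree k r).map (hκ h) ((φ q).symm y) =
        (φ q').symm (DSumMap k _ _ _ h y) := fun q q' h y => by
      rw [LinearEquiv.eq_symm_apply, ← hφ, LinearEquiv.apply_symm_apply]
    refine HasDownsetResolutionLT.cons (N' := M'.comap κ hκ)
      (fun q => (φ q).toLinearMap ∘ₗ f.app (κ q) ∘ₗ e.app q)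
      (fun q => g.app (κ q) ∘ₗ (φ q).symm.toLinearMap) ?_ ?_ ?_ ?_ ?_
      (ih hM' (M'.comap κ hκ) ⟨fun _ => LinearMap.id, fun _ _ => rfl⟩
        fun _ => Function.bijective_id)
    · intro q q' h
      ext1 x
      refine (hφ q q' h _).trans ?_
      refine congrArg (φ q') ?_
      exact (f.comm (hκ h) (e.app q x)).symm.trans (congrArg (f.app (κ q')) (e.comm h x).symm)
    · intro q q' h
      refine LinearMap.ext fun y => ?_
      refine (g.comm (hκ h) _).symm.trans ?_
      exact congrArg (g.app (κ q')) (hφ' q q' h y)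
    · intro q
      exact (φ q).injective.comp ((hs.inj _).comp (he q).1)
    · intro q y
      constructor
      · intro hy
        obtain ⟨x, hx⟩ := (hs.exact _ _).1 hy
        obtain ⟨z, rfl⟩ := (he q).2 x
        exact ⟨z, (LinearEquiv.eq_symm_apply _).1 hx⟩
      · rintro ⟨z, rfl⟩
        refine (hs.exact _ _).2 ⟨e.app q z, ?_⟩
        exact ((φ q).symm_apply_apply _).symm
    · intro q
      exact (hs.surj _).comp (φ q).symm.surjective

lemma hasDownsetResolutionLT_of_finDet {n : ℕ} (N : PRep k (Fin n → ℤ))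
    (hN : FinDet k N.X fun {_ _} h => N.map h) : HasDownsetResolutionLT N (n + 1) := by
  obtain ⟨hfd, hiso⟩ := hN
  choose c hc using hiso
  obtain ⟨C, hC⟩ : ∃ C : ℕ, ∀ i, c i ≤ C :=
    ⟨∑ i, (c i).natAbs, fun i => by
      have : (c i).natAbs ≤ ∑ i, (c i).natAbs :=
        Finset.single_le_sum (f := fun i => (c i).natAbs) (fun _ _ => Nat.zero_le _)
          (Finset.mem_univ i)
      have h2 := Int.le_natAbs (a := c i)
      omega⟩
  have hbij := bijective_map_of_path N C fun i b hb _ => hc i b ((hC i).trans_lt hb)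
  let κ : (Fin n → ℤ) → Fin n → Fin (2 * C + 1 + 1) := fun q i =>
    ⟨(min (max (q i) (-C)) (C + 1) + C).toNat, by omega⟩
  let ι : (Fin n → Fin (2 * C + 1 + 1)) → Fin n → ℤ := fun p i => (p i : ℕ) - C
  have hκ : Monotone κ := fun q q' h i => by
    have : q i ≤ q' i := h i
    simp only [κ, Fin.mk_le_mk]
    omega
  have hι : Monotone ι := fun p p' h i => by
    have h1 : (p i : ℕ) ≤ p' i := h i
    simp only [ι]
    omega
  have hικ : ∀ q i, ι (κ q) i = min (max (q i) (-C)) (C + 1) := fun q i => by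
    simp only [ι, κ]
    omega
  have hmax : Monotone fun (q : Fin n → ℤ) i => max (q i) (-(C : ℤ)) := fun q q' h i =>
    max_le_max_right _ (h i)
  have ha : ∀ q : Fin n → ℤ, q ≤ fun i => max (q i) (-(C : ℤ)) := fun q i => le_max_left _ _
  have hb : ∀ q : Fin n → ℤ, ι (κ q) ≤ fun i => max (q i) (-(C : ℤ)) := fun q i => by
    rw [hικ]
    exact min_le_left _ _
  obtain ⟨e, he⟩ := exists_hom_of_cospan (N := N) (N₁ := (N.comap ι hι).comap κ hκ)
    (N₂ := N.comap _ hmax)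
    ⟨fun q => N.map (ha q), fun h x => (N.map_map _ _ _).trans (N.map_map _ _ _).symm⟩
    ⟨fun q => N.map (hb q), fun h x => (N.map_map _ _ _).trans (N.map_map _ _ _).symm⟩
    (fun q => hbij _ _ _ _ rfl fun i hi => Or.inl (by
      have hi' : q i ≠ max (q i) (-(C : ℤ)) := hi
      change max (q i) (-(C : ℤ)) ≤ -C
      omega))
    (fun q => hbij _ _ _ _ rfl fun i hi => Or.inr (by
      have hi' : ι (κ q) i ≠ max (q i) (-(C : ℤ)) := hi
      rw [hικ] at hi' ⊢
      omega))
  refine ResLT.hasDownsetResolutionLT κ hκ ι (fun p => {i | p i = Fin.last _}) ?_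
    (resLT_of_finiteDimensional _ _ (N.comap ι hι) fun p => hfd _) N e he
  intro p q
  rw [mem_downInj]
  refine forall_congr' fun i => ?_
  have h1 := (p i).2
  simp only [Set.mem_ofPred_eq, Fin.ext_iff, Fin.val_last, ι, κ, Fin.le_def]
  omega

end PRep

lemma exists_DSumMap_bijective (k : Type) [Field k] {n m : ℕ} (b : Fin m → Fin n → ℤ)
    (τ : Fin m → Set (Fin n)) (i : Fin n) :
    ∃ c : ℤ, ∀ q : Fin n → ℤ, c < |q i| → ∀ h : q ≤ q + Pi.single i 1,
      Function.Bijective (DSumMap k m b τ h) := by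
  refine ⟨∑ j, |b j i|, fun q hq h => ?_⟩
  have key : ∀ j, Function.Bijective (stMap k (downInj (b j) (τ j)) h) := by
    intro j
    apply stMap_bijective
    rw [mem_downInj, mem_downInj]
    refine forall_congr' fun l => ?_
    by_cases hl : l = i
    · subst hl
      have h1 : |b j l| ≤ ∑ j, |b j l| :=
        Finset.single_le_sum (f := fun j => |b j l|) (fun _ _ => abs_nonneg _) (Finset.mem_univ j)
      have h2 := h1.trans_lt hq
      have h3 := neg_abs_le (b j l)
      have h4 := le_abs_self (b j l)
      rw [Pi.add_apply, Pi.single_eq_same]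
      refine imp_congr_right fun _ => ?_
      rcases lt_abs.1 h2 with h5 | h5 <;> omega
    · simp [hl]
  exact ⟨fun x y hxy => funext fun j => (key j).1 (congrFun hxy j), fun y => by
    choose x hx using fun j => (key j).2 (y j)
    exact ⟨x, funext hx⟩⟩

lemma finDet_of_hasFiniteDownsetResolution {k : Type} [Field k] {n : ℕ}
    (N : (Fin n → ℤ) → Type) [∀ a, AddCommGroup (N a)] [∀ a, Module k (N a)]
    (f : ∀ {a b : Fin n → ℤ}, a ≤ b → (N a →ₗ[k] N b)) {ℓ : ℕ}
    (H : HasFiniteDownsetResolution k N (fun {_ _} h => f h) ℓ) :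
    FinDet k N (fun {_ _} h => f h) := by
  obtain ⟨m, b, τ, -, ε, δ, hε, hδ, hinj, hex, -⟩ := H
  refine ⟨fun a => FiniteDimensional.of_injective (ε a) (hinj a), fun i => ?_⟩
  obtain ⟨c₀, h₀⟩ := exists_DSumMap_bijective k (b 0) (τ 0) i
  obtain ⟨c₁, h₁⟩ := exists_DSumMap_bijective k (b 1) (τ 1) i
  refine ⟨max c₀ c₁, fun q hq => ?_⟩
  have hle : q ≤ q + Pi.single i 1 := le_add_of_nonneg_right (Pi.single_nonneg.mpr zero_le_one)
  have hb₀ := h₀ q ((le_max_left _ _).trans_lt hq) hle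
  have hb₁ := h₁ q ((le_max_right _ _).trans_lt hq) hle
  have hε' := fun x => LinearMap.congr_fun (hε _ _ hle) x
  have hδ' := fun x => LinearMap.congr_fun (hδ 0 _ _ hle) x
  simp only [LinearMap.comp_apply] at hε' hδ'
  have hex' : ∀ q y, δ 0 q y = 0 ↔ ∃ x, ε q x = y := fun q y => by
    rw [← LinearMap.mem_ker, ← hex, LinearMap.mem_range]
  constructor
  · intro x y hxy
    refine hinj q (hb₀.1 ?_)
    rw [hε', hε']
    exact congrArg _ hxy
  · intro y
    obtain ⟨z, hz⟩ := hb₀.2 (ε _ y)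
    have h2 : δ 0 q z = 0 := by
      refine hb₁.1 ?_
      rw [map_zero]
      refine (hδ' z).trans ?_
      rw [hz]
      exact (hex' _ _).2 ⟨y, rfl⟩
    obtain ⟨x, rfl⟩ := (hex' _ _).1 h2
    refine ⟨x, hinj _ ?_⟩
    rw [← hz, hε']

/-- A `ℤⁿ`-module `N` is finitely determined if and only if it admits a
finite downset (injective-type) resolution `0 → N → E⁰ → ⋯ → E^ℓ → 0`; moreover, when `N`
is finitely determined such a resolution exists with `ℓ ≤ n`. -/
theorem finitely_determined_iff_finite_downset_resolution
    (k : Type) [Field k] (n : ℕ)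
    (N : (Fin n → ℤ) → Type) [∀ a, AddCommGroup (N a)] [∀ a, Module k (N a)]
    (f : ∀ {a b : Fin n → ℤ}, a ≤ b → (N a →ₗ[k] N b))
    (f_id : ∀ a : Fin n → ℤ, f (le_refl a) = LinearMap.id)
    (f_comp : ∀ {a b c : Fin n → ℤ} (h : a ≤ b) (h' : b ≤ c),
      f h' ∘ₗ f h = f (h.trans h')) :
    (FinDet k N (fun {a b} h => f h) ↔
      ∃ ℓ : ℕ, HasFiniteDownsetResolution k N (fun {a b} h => f h) ℓ) ∧
    (FinDet k N (fun {a b} h => f h) →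
      ∃ ℓ : ℕ, ℓ ≤ n ∧ HasFiniteDownsetResolution k N (fun {a b} h => f h) ℓ) := by
  have key : FinDet k N (fun {a b} h => f h) →
      HasFiniteDownsetResolution k N (fun {a b} h => f h) n := by
    intro hN
    obtain ⟨m, b, τ, hm, H⟩ := PRep.hasDownsetResolutionLT_of_finDet
      (⟨N, fun h => f h, fun a x => LinearMap.congr_fun (f_id a) x,
        fun h h' x => LinearMap.congr_fun (f_comp h h') x⟩ : PRep k (Fin n → ℤ)) hN
    exact ⟨m, b, τ, hm, H⟩
  exact ⟨⟨fun hN => ⟨n, key hN⟩, fun ⟨_, H⟩ => finDet_of_hasFiniteDownsetResolution N f H⟩,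
    fun hN => ⟨n, le_rfl, key hN⟩⟩
end
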